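/- arXiv:math/0410275 — 4 statements merged into one kernel-verified Lean document; each statement's English description precedes it below -/
import Mathlib

section
/- For every n ≥ 2, the Artin group A of type B n admits a left-invariant linear order whose restriction to the submonoid of A generated by the Artin generators s 1, …, s n is a well-order (every nonempty subset of that submonoid has a least element). -/
/-- The alternating word `w k (a, b) = a b a b ⋯` (`k` factors) in the free group on `B`. -/
def artinWord {B : Type*} : ℕ → B → B → FreeGroup B
  | 0, _, _ => 1
  | (k + 1), a, b => FreeGroup.of a * artinWord k b a

/-- The Artin relators of a Coxeter matrix `m` : the relators
`w (m i j) (sᵢ, sⱼ) * (w (m i j) (sⱼ, sᵢ))⁻¹` for `i ≠ j` with `m i j ≠ 0`. -/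
def artinRels {B : Type*} (m : B → B → ℕ) : Set (FreeGroup B) :=
  { r | ∃ i j : B, i ≠ j ∧ m i j ≠ 0 ∧
      r = artinWord (m i j) i j * (artinWord (m i j) j i)⁻¹ }

/-- The Artin group of a Coxeter matrix `m`, as a presented group. -/
def ArtinGroup {B : Type*} (m : B → B → ℕ) : Type _ := PresentedGroup (artinRels m)

instance {B : Type*} (m : B → B → ℕ) : Group (ArtinGroup m) :=
  QuotientGroup.Quotient.group _

/-- The Artin generator `s i` of the Artin group. -/
def artinGen {B : Type*} (m : B → B → ℕ) (i : B) : ArtinGroup m := PresentedGroup.of i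

/-- The Coxeter matrix of type `Bₙ` (indices `0, …, n-1` correspond to `s 1, …, s n`):
`m i (i+1) = 3` for the first `n-2` consecutive pairs, `m (n-1) n = 4` for the last pair,
and `m i j = 2` whenever `|i - j| ≥ 2`. -/
def BTypeMatrix (n : ℕ) : Fin n → Fin n → ℕ := fun i j =>
  if i = j then 1
  else if ((i : ℕ) + 1 = (j : ℕ) ∧ (j : ℕ) = n - 1) ∨
          ((j : ℕ) + 1 = (i : ℕ) ∧ (i : ℕ) = n - 1) then 4
  else if (i : ℕ) + 1 = (j : ℕ) ∨ (j : ℕ) + 1 = (i : ℕ) then 3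
  else 2

namespace FreeGroup

/-- The position of the first letter of the reduced word of `g` in the enumeration
`∅, x₀, x₀⁻¹, x₁, x₁⁻¹, …`, where `∅` stands for the empty word. -/
def headRank (g : FreeGroup ℕ) : ℕ :=
  match g.toWord with
  | [] => 0
  | (k, b) :: _ => if b then 2 * k + 1 else 2 * k + 2

@[simp] lemma headRank_one : headRank 1 = 0 := by simp [headRank]

lemma toWord_of_mul (k : ℕ) (g : FreeGroup ℕ) :
    (of k * g).toWord = reduce ((k, true) :: g.toWord) := by
  rw [toWord_mul, toWord_of]
  simp

lemma toWord_of_inv_mul (k : ℕ) (g : FreeGroup ℕ) :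
    ((of k)⁻¹ * g).toWord = reduce ((k, false) :: g.toWord) := by
  rw [toWord_mul, toWord_inv, toWord_of]
  simp [invRev]

lemma headRank_of_mul {k : ℕ} {g : FreeGroup ℕ} (h : headRank g ≠ 2 * k + 2) :
    headRank (of k * g) = 2 * k + 1 := by
  unfold headRank at h ⊢
  rw [toWord_of_mul, reduce.cons, reduce_toWord]
  rcases hg : g.toWord with _ | ⟨⟨j, b⟩, t⟩
  · simp
  · rw [hg] at h
    cases b <;> simp_all
    grind

lemma headRank_of_inv_mul {k : ℕ} {g : FreeGroup ℕ} (h : headRank g ≠ 2 * k + 1) :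
    headRank ((of k)⁻¹ * g) = 2 * k + 2 := by
  unfold headRank at h ⊢
  rw [toWord_of_inv_mul, reduce.cons, reduce_toWord]
  rcases hg : g.toWord with _ | ⟨⟨j, b⟩, t⟩
  · simp
  · rw [hg] at h
    cases b <;> simp_all
    grind

/-- Induction along reduced words. -/
lemma reduced_induction {P : FreeGroup ℕ → Prop} (one : P 1)
    (of_mul : ∀ k g, headRank g ≠ 2 * k + 2 → P g → P (of k * g))
    (of_inv_mul : ∀ k g, headRank g ≠ 2 * k + 1 → P g → P ((of k)⁻¹ * g)) (g : FreeGroup ℕ) :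
    P g := by
  have key : ∀ L : List (ℕ × Bool), IsReduced L → P (mk L) := by
    intro L
    induction L with
    | nil => intro _; exact one
    | cons a t ih =>
      intro hL
      have ht : IsReduced t := List.IsChain.tail hL
      have hr : (mk t).toWord = t := by rw [toWord_mk]; exact ht.reduce_eq
      obtain ⟨k, b⟩ := a
      cases b
      · have : mk ((k, false) :: t) = (of k)⁻¹ * mk t := by simp [of, invRev]
        rw [this]
        refine of_inv_mul k _ ?_ (ih ht)
        unfold headRank
        rw [hr]
        rcases t with _ | ⟨⟨j, c⟩, t⟩
        · simp
        · cases c <;> simp_all [IsReduced]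
          · omega
          · grind
      · have : mk ((k, true) :: t) = of k * mk t := by simp [of]
        rw [this]
        refine of_mul k _ ?_ (ih ht)
        unfold headRank
        rw [hr]
        rcases t with _ | ⟨⟨j, c⟩, t⟩
        · simp
        · cases c <;> simp_all [IsReduced]
          · grind
          · omega
  rw [← mk_toWord (x := g)]
  exact key _ isReduced_toWord

lemma headRank_eq_zero {g : FreeGroup ℕ} : headRank g = 0 ↔ g = 1 := by
  refine ⟨fun h => ?_, fun h => by simp [h]⟩
  induction g using reduced_induction with
  | one => rfl
  | of_mul k g hg _ => rw [headRank_of_mul hg] at h; omega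
  | of_inv_mul k g hg _ => rw [headRank_of_inv_mul hg] at h; omega

/-- The cyclic order on `ℕ` obtained by cutting it at its end. -/
def CyclicLT (a b c : ℕ) : Prop := (a < b ∧ b < c) ∨ (b < c ∧ c < a) ∨ (c < a ∧ a < b)

/-- The left-invariant planar cyclic order on the free group: after a translation, the first
letters of the three elements are distinct and cyclically ordered. -/
def Cyc (u v w : FreeGroup ℕ) : Prop :=
  ∃ m, CyclicLT (headRank (m * u)) (headRank (m * v)) (headRank (m * w))

lemma exists_headRank_inv_mul (q : FreeGroup ℕ) (hq : q ≠ 1) :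
    ∃ c, ∀ g, headRank g ≠ headRank q → headRank (q⁻¹ * g) = c := by
  induction q using reduced_induction with
  | one => exact absurd rfl hq
  | of_mul k h hh ih =>
    by_cases h1 : h = 1
    · subst h1
      refine ⟨2 * k + 2, fun g hg => ?_⟩
      rw [headRank_of_mul hh] at hg
      simpa using headRank_of_inv_mul hg
    · obtain ⟨c, hc⟩ := ih h1
      refine ⟨c, fun g hg => ?_⟩
      rw [headRank_of_mul hh] at hg
      rw [mul_inv_rev, mul_assoc]
      apply hc
      rw [headRank_of_inv_mul hg]
      exact hh.symm
  | of_inv_mul k h hh ih =>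
    by_cases h1 : h = 1
    · subst h1
      refine ⟨2 * k + 1, fun g hg => ?_⟩
      rw [headRank_of_inv_mul hh] at hg
      simpa using headRank_of_mul hg
    · obtain ⟨c, hc⟩ := ih h1
      refine ⟨c, fun g hg => ?_⟩
      rw [headRank_of_inv_mul hh] at hg
      rw [mul_inv_rev, mul_assoc, inv_inv]
      apply hc
      rw [headRank_of_mul hg]
      exact hh.symm

/-- `m` separates `u`, `v`, `w`: its inverse is the median of the three elements in the
Cayley tree. -/
def Separates (m u v w : FreeGroup ℕ) : Prop :=
  headRank (m * u) ≠ headRank (m * v) ∧ headRank (m * v) ≠ headRank (m * w) ∧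
    headRank (m * w) ≠ headRank (m * u)

lemma Separates.unique {m m' u v w : FreeGroup ℕ} (h : Separates m u v w)
    (h' : Separates m' u v w) : m = m' := by
  by_contra hne
  have hq : m * m'⁻¹ ≠ 1 := fun h => hne (mul_inv_eq_one.1 h)
  obtain ⟨c, hc⟩ := exists_headRank_inv_mul _ hq
  have hu := hc (m * u)
  have hv := hc (m * v)
  have hw := hc (m * w)
  have e : ∀ g, (m * m'⁻¹)⁻¹ * (m * g) = m' * g := fun g => by group
  rw [e] at hu hv hw
  unfold Separates at h h'
  grind

lemma exists_separates_of_headRank_ne (u : FreeGroup ℕ) : ∀ g v : FreeGroup ℕ, u ≠ v →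
    headRank g ≠ headRank u → headRank g ≠ headRank v → ∃ m, Separates m g u v := by
  induction u using reduced_induction with
  | one =>
    intro g v huv h1 h2
    refine ⟨1, ?_⟩
    have := mt headRank_eq_zero.1 huv.symm
    simp only [Separates, one_mul, headRank_one] at *
    omega
  | of_mul k u hu ih =>
    intro g v huv h1 h2
    by_cases h : headRank (of k * u) = headRank v
    · rw [headRank_of_mul hu] at h h1
      have hv : headRank ((of k)⁻¹ * v) ≠ 2 * k + 2 := by
        intro h3
        induction v using reduced_induction with
        | one => simp at h
        | of_mul j v hv _ =>
          rw [headRank_of_mul hv] at h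
          obtain rfl : k = j := by omega
          simp at h3
          exact hv h3
        | of_inv_mul j v hv _ =>
          rw [headRank_of_inv_mul hv] at h
          omega
      obtain ⟨m, hm⟩ := ih ((of k)⁻¹ * g) ((of k)⁻¹ * v) (by rintro rfl; simp at huv)
        (by rw [headRank_of_inv_mul h1]; exact hu.symm)
        (by rw [headRank_of_inv_mul h1]; exact hv.symm)
      refine ⟨m * (of k)⁻¹, ?_⟩
      simpa [Separates, mul_assoc] using hm
    · exact ⟨1, by simp only [Separates, one_mul]; exact ⟨h1, h, h2.symm⟩⟩
  | of_inv_mul k u hu ih =>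
    intro g v huv h1 h2
    by_cases h : headRank ((of k)⁻¹ * u) = headRank v
    · rw [headRank_of_inv_mul hu] at h h1
      have hv : headRank (of k * v) ≠ 2 * k + 1 := by
        intro h3
        induction v using reduced_induction with
        | one => simp at h
        | of_mul j v hv _ =>
          rw [headRank_of_mul hv] at h
          omega
        | of_inv_mul j v hv _ =>
          rw [headRank_of_inv_mul hv] at h
          obtain rfl : k = j := by omega
          simp at h3
          exact hv h3
      obtain ⟨m, hm⟩ := ih (of k * g) (of k * v) (by rintro rfl; simp at huv)
        (by rw [headRank_of_mul h1]; exact hu.symm)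
        (by rw [headRank_of_mul h1]; exact hv.symm)
      refine ⟨m * of k, ?_⟩
      simpa [Separates, mul_assoc] using hm
    · exact ⟨1, by simp only [Separates, one_mul]; exact ⟨h1, h, h2.symm⟩⟩

lemma exists_separates {u v w : FreeGroup ℕ} (huv : u ≠ v) (hvw : v ≠ w) (hwu : w ≠ u) :
    ∃ m, Separates m u v w := by
  obtain ⟨m, hm⟩ := exists_separates_of_headRank_ne (u⁻¹ * v) 1 (u⁻¹ * w) (by simpa)
    (by rw [headRank_one]; exact fun h => huv (inv_mul_eq_one.1 (headRank_eq_zero.1 h.symm)))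
    (by rw [headRank_one]; exact fun h => hwu (inv_mul_eq_one.1 (headRank_eq_zero.1 h.symm)).symm)
  exact ⟨m * u⁻¹, by simpa [Separates, mul_assoc] using hm⟩

lemma CyclicLT.separates {m u v w : FreeGroup ℕ}
    (h : CyclicLT (headRank (m * u)) (headRank (m * v)) (headRank (m * w))) :
    Separates m u v w := by
  unfold CyclicLT at h
  unfold Separates
  omega

lemma Separates.symm {m u v w : FreeGroup ℕ} (h : Separates m u v w) : Separates m u w v :=
  ⟨h.2.2.symm, h.2.1.symm, h.1.symm⟩

lemma Cyc.ne {u v w : FreeGroup ℕ} (h : Cyc u v w) : u ≠ v ∧ v ≠ w ∧ w ≠ u := by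
  obtain ⟨m, hm⟩ := h
  have := CyclicLT.separates hm
  refine ⟨?_, ?_, ?_⟩ <;> rintro rfl <;> simp [Separates] at this

lemma Cyc.asymm {u v w : FreeGroup ℕ} (h : Cyc u v w) : ¬ Cyc u w v := by
  rintro ⟨m', hm'⟩
  obtain ⟨m, hm⟩ := h
  obtain rfl := (CyclicLT.separates hm).unique (CyclicLT.separates hm').symm
  unfold CyclicLT at hm hm'
  omega

lemma Cyc.total {u v w : FreeGroup ℕ} (huv : u ≠ v) (hvw : v ≠ w) (hwu : w ≠ u) :
    Cyc u v w ∨ Cyc u w v := by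
  obtain ⟨m, hm⟩ := exists_separates huv hvw hwu
  have : CyclicLT (headRank (m * u)) (headRank (m * v)) (headRank (m * w)) ∨
      CyclicLT (headRank (m * u)) (headRank (m * w)) (headRank (m * v)) := by
    unfold Separates at hm
    unfold CyclicLT
    omega
  exact this.imp (fun h => ⟨m, h⟩) (fun h => ⟨m, h⟩)

lemma CyclicLT.headRank_eq {m₁ m₂ m₃ o u v w : FreeGroup ℕ}
    (h₁ : CyclicLT (headRank (m₁ * o)) (headRank (m₁ * u)) (headRank (m₁ * v)))
    (h₂ : CyclicLT (headRank (m₂ * o)) (headRank (m₂ * v)) (headRank (m₂ * w)))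
    (h₃ : CyclicLT (headRank (m₃ * o)) (headRank (m₃ * w)) (headRank (m₃ * u))) :
    headRank (m₁ * w) = headRank (m₁ * o) := by
  by_contra hne
  have s₁ := CyclicLT.separates h₁
  by_cases hv : headRank (m₁ * w) = headRank (m₁ * v)
  · obtain rfl : m₁ = m₃ := Separates.unique
      ⟨Ne.symm hne, by rw [hv]; exact s₁.2.1.symm, s₁.1.symm⟩ (CyclicLT.separates h₃)
    rw [hv] at h₃
    clear h₂ s₁ hne hv
    unfold CyclicLT at h₁ h₃
    omega
  · obtain rfl : m₁ = m₂ := Separates.unique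
      ⟨s₁.2.2.symm, Ne.symm hv, hne⟩ (CyclicLT.separates h₂)
    by_cases hu : headRank (m₁ * w) = headRank (m₁ * u)
    · rw [hu] at h₂
      clear h₃ s₁ hne hv
      unfold CyclicLT at h₁ h₂
      omega
    · obtain rfl : m₁ = m₃ := Separates.unique
        ⟨Ne.symm hne, hu, s₁.1.symm⟩ (CyclicLT.separates h₃)
      clear s₁ hne hv hu
      unfold CyclicLT at h₁ h₂ h₃
      omega

lemma Cyc.trans {o u v w : FreeGroup ℕ} (h₁ : Cyc o u v) (h₂ : Cyc o v w) : Cyc o u w := by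
  have huw : u ≠ w := by rintro rfl; exact h₁.asymm h₂
  refine (Cyc.total h₁.ne.1 huw h₂.ne.2.2).resolve_right ?_
  rintro ⟨m₃, h₃⟩
  obtain ⟨m₁, h₁⟩ := h₁
  obtain ⟨m₂, h₂⟩ := h₂
  have e₁ := CyclicLT.headRank_eq h₁ h₂ h₃
  have e₂ := CyclicLT.headRank_eq h₂ h₃ h₁
  have s₁ := CyclicLT.separates h₁
  have s₂ := CyclicLT.separates h₂
  obtain rfl : m₁ = m₂ := Separates.unique (u := u) (v := v) (w := w)
    ⟨s₁.2.1, by rw [e₁]; exact s₁.2.2, by rw [e₁]; exact s₁.1⟩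
    ⟨by rw [e₂]; exact s₂.1, s₂.2.1, by rw [e₂]; exact s₂.2.2⟩
  exact s₂.2.2 e₁

/-- The nontrivial elements of the free group, ordered by cutting the cyclic order at `1`. -/
abbrev Nontriv := {u : FreeGroup ℕ // u ≠ 1}

noncomputable instance : LinearOrder Nontriv :=
  haveI : IsStrictTotalOrder Nontriv (fun u v => Cyc 1 u.1 v.1) :=
    { irrefl := fun _ h => h.ne.2.1 rfl
      trans := fun _ _ _ h h' => h.trans h'
      trichotomous := fun u v h h' => by
        by_contra hne
        rcases Cyc.total u.2.symm (fun h => hne (Subtype.ext h)) v.2 with h'' | h''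
        · exact h h''
        · exact h' h'' }
  haveI := Classical.decRel (fun u v : Nontriv => Cyc 1 u.1 v.1)
  linearOrderOfSTO (fun u v : Nontriv => Cyc 1 u.1 v.1)

end FreeGroup

namespace FreeGroup

/-- The endomorphism underlying Artin's action of the `i`-th braid generator. -/
def artinHom (i : ℕ) : FreeGroup ℕ →* FreeGroup ℕ :=
  lift fun k => if k = i then of i * of (i + 1) * (of i)⁻¹ else if k = i + 1 then of i else of k

/-- The inverse of `artinHom i`. -/
def artinInvHom (i : ℕ) : FreeGroup ℕ →* FreeGroup ℕ :=
  lift fun k => if k = i then of (i + 1) else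
    if k = i + 1 then (of (i + 1))⁻¹ * of i * of (i + 1) else of k

/-- Artin's automorphism of the free group attached to the `i`-th braid generator. -/
def artinAut (i : ℕ) : MulAut (FreeGroup ℕ) :=
  MonoidHom.toMulEquiv (artinHom i) (artinInvHom i)
    (by
      ext k
      by_cases h : k = i
      · subst h; simp [artinHom, artinInvHom, mul_assoc]
      · by_cases h' : k = i + 1
        · subst h'; simp [artinHom, artinInvHom]
        · simp [artinHom, artinInvHom, h, h'])
    (by
      ext k
      by_cases h : k = i
      · subst h; simp [artinHom, artinInvHom]
      · by_cases h' : k = i + 1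
        · subst h'; simp [artinHom, artinInvHom, mul_assoc]
        · simp [artinHom, artinInvHom, h, h'])

lemma artinAut_of (i k : ℕ) : artinAut i (of k) =
    if k = i then of i * of (i + 1) * (of i)⁻¹ else if k = i + 1 then of i else of k := by
  simp [artinAut, artinHom]

@[simp] lemma artinAut_of_self (i : ℕ) :
    artinAut i (of i) = of i * of (i + 1) * (of i)⁻¹ := by simp [artinAut_of]

@[simp] lemma artinAut_of_succ (i : ℕ) : artinAut i (of (i + 1)) = of i := by simp [artinAut_of]

lemma artinAut_of_ne {i k : ℕ} (h : k ≠ i) (h' : k ≠ i + 1) : artinAut i (of k) = of k := by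
  simp [artinAut_of, h, h']

lemma mulAut_ext {f g : MulAut (FreeGroup ℕ)} (h : ∀ k, f (of k) = g (of k)) : f = g := by
  have : f.toMonoidHom = g.toMonoidHom := by ext k; exact h k
  exact MulEquiv.toMonoidHom_injective this

lemma artinAut_comm {i j : ℕ} (h : i + 1 < j) :
    artinAut i * artinAut j = artinAut j * artinAut i := by
  apply mulAut_ext
  intro k
  simp only [MulAut.mul_apply]
  rcases eq_or_ne k i with rfl | h₁
  · simp [artinAut_of_ne (i := j) (k := k) (by omega) (by omega),
      artinAut_of_ne (i := j) (k := k + 1) (by omega) (by omega)]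
  rcases eq_or_ne k (i + 1) with rfl | h₂
  · simp [artinAut_of_ne (i := j) (k := i) (by omega) (by omega),
      artinAut_of_ne (i := j) (k := i + 1) (by omega) (by omega)]
  rw [artinAut_of_ne h₁ h₂]
  rcases eq_or_ne k j with rfl | h₃
  · simp [artinAut_of_ne (i := i) (k := k) (by omega) (by omega),
      artinAut_of_ne (i := i) (k := k + 1) (by omega) (by omega)]
  rcases eq_or_ne k (j + 1) with rfl | h₄
  · simp [artinAut_of_ne (i := i) (k := j) (by omega) (by omega)]
  rw [artinAut_of_ne h₃ h₄, artinAut_of_ne h₁ h₂]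

lemma artinAut_braid (i : ℕ) :
    artinAut i * artinAut (i + 1) * artinAut i =
      artinAut (i + 1) * artinAut i * artinAut (i + 1) := by
  have e₁ := artinAut_of_ne (i := i + 1) (k := i) (by omega) (by omega)
  have e₂ := artinAut_of_ne (i := i) (k := i + 1 + 1) (by omega) (by omega)
  apply mulAut_ext
  intro k
  simp only [MulAut.mul_apply]
  rcases eq_or_ne k i with rfl | h₁
  · simp [e₁, e₂, mul_assoc]
  rcases eq_or_ne k (i + 1) with rfl | h₂
  · simp [e₁, e₂]
  rcases eq_or_ne k (i + 1 + 1) with rfl | h₃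
  · simp [e₁, e₂]
  simp [artinAut_of_ne h₁ h₂, artinAut_of_ne h₂ h₃]

lemma headRank_artinAut (i : ℕ) (g : FreeGroup ℕ) :
    (headRank g = 2 * i + 1 ∧ headRank (artinAut i g) = 2 * i + 1 ∧
      headRank ((of i)⁻¹ * artinAut i g) = 2 * i + 3) ∨
    (headRank g = 2 * i + 2 ∧ headRank (artinAut i g) = 2 * i + 1 ∧
      headRank ((of i)⁻¹ * artinAut i g) = 2 * i + 4) ∨
    (headRank g = 2 * i + 3 ∧ headRank (artinAut i g) = 2 * i + 1 ∧
      (headRank ((of i)⁻¹ * artinAut i g) ≤ 2 * i + 1 ∨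
        2 * i + 5 ≤ headRank ((of i)⁻¹ * artinAut i g))) ∨
    (headRank g = 2 * i + 4 ∧ (2 * i + 2 ≤ headRank (artinAut i g) ∧
      headRank (artinAut i g) ≤ 2 * i + 4) ∧
      headRank ((of i)⁻¹ * artinAut i g) = 2 * i + 2) ∨
    ((headRank g ≤ 2 * i ∨ 2 * i + 5 ≤ headRank g) ∧ headRank (artinAut i g) = headRank g ∧
      headRank ((of i)⁻¹ * artinAut i g) = 2 * i + 2) := by
  induction g using reduced_induction with
  | one =>
    have := headRank_of_inv_mul (k := i) (g := 1) (by simp)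
    simp at this
    simp [this]
  | of_mul k g hg ih =>
    rw [headRank_of_mul hg, _root_.map_mul]
    rcases eq_or_ne k i with rfl | h₁
    · have a : headRank (of (k + 1) * ((of k)⁻¹ * artinAut k g)) = 2 * (k + 1) + 1 :=
        headRank_of_mul (by omega)
      have b : headRank (of k * (of (k + 1) * ((of k)⁻¹ * artinAut k g))) = 2 * k + 1 :=
        headRank_of_mul (by omega)
      simp only [artinAut_of_self, mul_assoc, inv_mul_cancel_left, true_and]
      omega
    rcases eq_or_ne k (i + 1) with rfl | h₂
    · have a : headRank (of i * artinAut i g) = 2 * i + 1 := headRank_of_mul (by omega)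
      simp only [artinAut_of_succ, inv_mul_cancel_left]
      omega
    · rw [artinAut_of_ne h₁ h₂]
      have a : headRank (of k * artinAut i g) = 2 * k + 1 := headRank_of_mul (by omega)
      have b : headRank ((of i)⁻¹ * (of k * artinAut i g)) = 2 * i + 2 :=
        headRank_of_inv_mul (by omega)
      omega
  | of_inv_mul k g hg ih =>
    rw [headRank_of_inv_mul hg, _root_.map_mul, _root_.map_inv]
    rcases eq_or_ne k i with rfl | h₁
    · have a : headRank ((of (k + 1))⁻¹ * ((of k)⁻¹ * artinAut k g)) = 2 * (k + 1) + 2 :=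
        headRank_of_inv_mul (by omega)
      have b : headRank (of k * ((of (k + 1))⁻¹ * ((of k)⁻¹ * artinAut k g))) = 2 * k + 1 :=
        headRank_of_mul (by omega)
      simp only [artinAut_of_self, mul_inv_rev, inv_inv, mul_assoc, inv_mul_cancel_left, true_and]
      omega
    rcases eq_or_ne k (i + 1) with rfl | h₂
    · rw [artinAut_of_succ]
      have b : headRank ((of i)⁻¹ * ((of i)⁻¹ * artinAut i g)) = 2 * i + 2 :=
        headRank_of_inv_mul (by omega)
      omega
    · rw [artinAut_of_ne h₁ h₂]
      have a : headRank ((of k)⁻¹ * artinAut i g) = 2 * k + 2 := headRank_of_inv_mul (by omega)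
      have b : headRank ((of i)⁻¹ * ((of k)⁻¹ * artinAut i g)) = 2 * i + 2 :=
        headRank_of_inv_mul (by omega)
      omega

lemma Cyc.artinAut {u v w : FreeGroup ℕ} (i : ℕ) (h : Cyc u v w) :
    Cyc (artinAut i u) (artinAut i v) (artinAut i w) := by
  obtain ⟨m, hm⟩ := h
  have hu := headRank_artinAut i (m * u)
  have hv := headRank_artinAut i (m * v)
  have hw := headRank_artinAut i (m * w)
  by_cases h : CyclicLT (headRank (FreeGroup.artinAut i (m * u)))
    (headRank (FreeGroup.artinAut i (m * v))) (headRank (FreeGroup.artinAut i (m * w)))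
  · exact ⟨FreeGroup.artinAut i m, by simpa using h⟩
  · refine ⟨(of i)⁻¹ * FreeGroup.artinAut i m, ?_⟩
    simp only [mul_assoc, ← _root_.map_mul]
    generalize headRank (m * u) = a at *
    generalize headRank (m * v) = b at *
    generalize headRank (m * w) = c at *
    generalize headRank ((of i)⁻¹ * FreeGroup.artinAut i (m * u)) = a' at *
    generalize headRank ((of i)⁻¹ * FreeGroup.artinAut i (m * v)) = b' at *
    generalize headRank ((of i)⁻¹ * FreeGroup.artinAut i (m * w)) = c' at *
    unfold CyclicLT at *
    rcases hu with hu | hu | hu | hu | hu <;> rcases hv with hv | hv | hv | hv | hv <;>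
      rcases hw with hw | hw | hw | hw | hw <;> omega

/-- The automorphisms of the free group preserving its planar cyclic order. -/
def cycAut : Subgroup (MulAut (FreeGroup ℕ)) where
  carrier := {f | ∀ u v w, Cyc (f u) (f v) (f w) ↔ Cyc u v w}
  one_mem' _ _ _ := Iff.rfl
  mul_mem' hf hg u v w := (hf _ _ _).trans (hg _ _ _)
  inv_mem' {f} hf u v w := by
    simpa using (hf (f⁻¹ u) (f⁻¹ v) (f⁻¹ w)).symm

lemma artinAut_mem_cycAut (i : ℕ) : artinAut i ∈ cycAut := by
  intro u v w
  refine ⟨fun h => ?_, fun h => h.artinAut i⟩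
  by_contra hn
  obtain ⟨h₁, h₂, h₃⟩ := h.ne
  have := (Cyc.total (fun e => h₁ (congrArg _ e)) (fun e => h₂ (congrArg _ e))
    (fun e => h₃ (congrArg _ e))).resolve_left hn
  exact h.asymm (this.artinAut i)

end FreeGroup

section Push

variable {G : Type*} [Group G]

/-- The first `M` terms of `s` satisfy the braid relations. -/
structure IsBraid (s : ℕ → G) (M : ℕ) : Prop where
  comm : ∀ i j, i + 1 < j → j < M → Commute (s i) (s j)
  braid : ∀ i, i + 1 < M → s i * s (i + 1) * s i = s (i + 1) * s i * s (i + 1)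

/-- The first `M` terms of `s` together with `t` satisfy the Artin relations of type `B`. -/
structure IsTypeB (s : ℕ → G) (t : G) (M : ℕ) : Prop extends IsBraid s M where
  comm_last : ∀ i, i + 1 < M → Commute (s i) t
  braid_last : ∀ i, i + 1 = M → s i * t * s i * t = t * s i * t * s i

/-- The element pushing the last puncture around the `j`-th one. -/
def pushElt (s : ℕ → G) (t : G) (M : ℕ) (j : ℕ) : G :=
  if j < M then s j * pushElt s t M (j + 1) * (s j)⁻¹ else t
termination_by M - j

lemma pushElt_of_lt (s : ℕ → G) (t : G) {M j : ℕ} (h : j < M) :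
    pushElt s t M j = s j * pushElt s t M (j + 1) * (s j)⁻¹ := by
  rw [pushElt, if_pos h]

lemma pushElt_of_le (s : ℕ → G) (t : G) {M j : ℕ} (h : M ≤ j) : pushElt s t M j = t := by
  rw [pushElt, if_neg (by omega)]

lemma SemiconjBy.commute_of_commute {u a b a' b' : G} (ha : SemiconjBy u a a')
    (hb : SemiconjBy u b b') (h : Commute a b) : Commute a' b' := by
  have ha' : a' = u * a * u⁻¹ := by rw [ha.eq]; group
  have hb' : b' = u * b * u⁻¹ := by rw [hb.eq]; group
  subst ha' hb'
  have := congrArg (fun x => u * x * u⁻¹) h.eq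
  simpa [Commute, SemiconjBy, mul_assoc] using this

namespace IsTypeB

variable {s : ℕ → G} {t : G} {M : ℕ}

lemma commute_pushElt_of_lt (h : IsTypeB s t M) {i j : ℕ} (hij : i + 1 < j) (hj : j ≤ M) :
    Commute (s i) (pushElt s t M j) := by
  induction hj using Nat.decreasingInduction with
  | self => rw [pushElt_of_le s t le_rfl]; exact h.comm_last i hij
  | of_succ j hj ih =>
    rw [pushElt_of_lt s t hj]
    have := h.comm i j hij hj
    exact (this.mul_right (ih (by omega))).mul_right this.inv_right

lemma commute_pushElt_of_gt (h : IsTypeB s t M) {i j : ℕ} (hij : j < i) (hi : i < M) :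
    Commute (s i) (pushElt s t M j) := by
  have hj : j ≤ M := by omega
  induction hj using Nat.decreasingInduction with
  | self => omega
  | of_succ j hj ih =>
    rcases Nat.lt_or_ge (j + 1) i with h1 | h1
    · rw [pushElt_of_lt s t hj]
      have := (h.comm j i h1 hi).symm
      exact (this.mul_right (ih (by omega))).mul_right this.inv_right
    · obtain rfl : i = j + 1 := by omega
      rw [pushElt_of_lt s t hj, pushElt_of_lt s t hi]
      refine SemiconjBy.commute_of_commute (u := s j * s (j + 1)) (a := s j)
        (b := pushElt s t M (j + 1 + 1)) ?_ ?_ (h.commute_pushElt_of_lt (by omega) (by omega))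
      · rw [SemiconjBy, h.braid j hi, mul_assoc]
      · simp [SemiconjBy, mul_assoc]

lemma semiconjBy_pushElt (s : ℕ → G) (t : G) {j : ℕ} (hj : j < M) :
    SemiconjBy (s j) (pushElt s t M (j + 1)) (pushElt s t M j) := by
  rw [pushElt_of_lt s t hj]
  simp [SemiconjBy]

lemma commute_pushElt_mul (h : IsTypeB s t M) {j : ℕ} (hj : j < M) :
    Commute (s j) (pushElt s t M (j + 1) * pushElt s t M j) := by
  obtain ⟨m, rfl⟩ : ∃ m, M = m + 1 := ⟨M - 1, by omega⟩
  have hj' : j ≤ m := by omega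
  induction hj' using Nat.decreasingInduction with
  | self =>
    rw [pushElt_of_lt s t hj, pushElt_of_le s t le_rfl]
    have := h.braid_last m rfl
    simp only [Commute, SemiconjBy, mul_assoc] at this ⊢
    rw [inv_mul_cancel, mul_one, ← mul_right_inj t⁻¹, ← mul_left_inj (s m)]
    simp only [mul_assoc, inv_mul_cancel, inv_mul_cancel_left, mul_one]
    rw [inv_mul_eq_iff_eq_mul, this]
  | of_succ j hjm ih =>
    have hu₁ : SemiconjBy (s (j + 1) * s j) (s (j + 1)) (s j) := by
      rw [SemiconjBy, ← h.braid j (by omega), mul_assoc]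
    have hu₂ : SemiconjBy (s (j + 1) * s j) (pushElt s t (m + 1) (j + 1 + 1))
        (pushElt s t (m + 1) (j + 1)) :=
      (semiconjBy_pushElt s t (by omega)).mul_left
        (h.commute_pushElt_of_lt (by omega) (by omega))
    have hu₃ : SemiconjBy (s (j + 1) * s j) (pushElt s t (m + 1) (j + 1))
        (pushElt s t (m + 1) j) :=
      SemiconjBy.mul_left (h.commute_pushElt_of_gt (by omega) (by omega))
        (semiconjBy_pushElt s t (by omega))
    exact SemiconjBy.commute_of_commute hu₁ (hu₂.mul_right hu₃) (ih (by omega))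

/-- The subgroup of pushing elements. -/
def pushSubgroup (s : ℕ → G) (t : G) (M : ℕ) : Subgroup G :=
  Subgroup.closure (Set.range (pushElt s t M))

lemma pushElt_mem (s : ℕ → G) (t : G) (M j : ℕ) : pushElt s t M j ∈ pushSubgroup s t M :=
  Subgroup.subset_closure ⟨j, rfl⟩

lemma conj_pushElt_mem (h : IsTypeB s t M) {i j : ℕ} (hi : i < M) (hj : j ≤ M) :
    s i * pushElt s t M j * (s i)⁻¹ ∈ pushSubgroup s t M ∧
      (s i)⁻¹ * pushElt s t M j * s i ∈ pushSubgroup s t M := by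
  have key : Commute (s i) (pushElt s t M j) →
      s i * pushElt s t M j * (s i)⁻¹ ∈ pushSubgroup s t M ∧
      (s i)⁻¹ * pushElt s t M j * s i ∈ pushSubgroup s t M := by
    intro hc
    rw [hc.eq, mul_inv_cancel_right, mul_assoc, ← hc.eq, inv_mul_cancel_left]
    exact ⟨pushElt_mem s t M j, pushElt_mem s t M j⟩
  have e₁ := (semiconjBy_pushElt s t hi).eq
  have e₂ := (h.commute_pushElt_mul hi).eq
  have m₁ := pushElt_mem s t M i
  have m₂ := pushElt_mem s t M (i + 1)
  rcases lt_trichotomy i j with hij | rfl | hij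
  · rcases Nat.lt_or_ge (i + 1) j with h1 | h1
    · exact key (h.commute_pushElt_of_lt h1 hj)
    · obtain rfl : j = i + 1 := by omega
      generalize pushElt s t M (i + 1) = b at *
      generalize pushElt s t M i = a at *
      have : (s i)⁻¹ * b * s i = b * a * b⁻¹ := by
        rw [eq_mul_inv_iff_mul_eq, mul_assoc, mul_assoc, inv_mul_eq_iff_eq_mul, e₂,
          mul_assoc, e₁]
      rw [e₁, mul_inv_cancel_right, this]
      exact ⟨m₁, mul_mem (mul_mem m₂ m₁) (inv_mem m₂)⟩
  · generalize pushElt s t M (i + 1) = b at *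
    generalize pushElt s t M i = a at *
    have : s i * a * (s i)⁻¹ = a⁻¹ * b * a := by
      rw [mul_inv_eq_iff_eq_mul, mul_assoc, mul_assoc, eq_inv_mul_iff_mul_eq, ← mul_assoc, ← e₁,
        mul_assoc, e₂, mul_assoc, e₁]
    rw [this, mul_assoc (s i)⁻¹, ← e₁, inv_mul_cancel_left]
    exact ⟨mul_mem (mul_mem (inv_mem m₁) m₂) m₁, m₂⟩
  · exact key (h.commute_pushElt_of_gt hij hi)

lemma conj_mem_pushSubgroup (h : IsTypeB s t M) {i : ℕ} (hi : i < M) {y : G}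
    (hy : y ∈ pushSubgroup s t M) :
    s i * y * (s i)⁻¹ ∈ pushSubgroup s t M ∧ (s i)⁻¹ * y * s i ∈ pushSubgroup s t M := by
  have gen : ∀ j, s i * pushElt s t M j * (s i)⁻¹ ∈ pushSubgroup s t M ∧
      (s i)⁻¹ * pushElt s t M j * s i ∈ pushSubgroup s t M := by
    intro j
    rcases le_total j M with hj | hj
    · exact h.conj_pushElt_mem hi hj
    · rw [(pushElt_of_le s t hj).trans (pushElt_of_le s t (le_refl M)).symm]
      exact h.conj_pushElt_mem hi le_rfl
  have h₁ : pushSubgroup s t M ≤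
      (pushSubgroup s t M).comap (MulAut.conj (s i)).toMonoidHom := by
    refine (Subgroup.closure_le _).2 ?_
    rintro _ ⟨j, rfl⟩
    simpa using (gen j).1
  have h₂ : pushSubgroup s t M ≤
      (pushSubgroup s t M).comap (MulAut.conj (s i)⁻¹).toMonoidHom := by
    refine (Subgroup.closure_le _).2 ?_
    rintro _ ⟨j, rfl⟩
    simpa using (gen j).2
  exact ⟨by simpa using h₁ hy, by simpa using h₂ hy⟩

lemma exists_eq_mul (h : IsTypeB s t M) {g : G}
    (hg : g ∈ Subgroup.closure (insert t (s '' Set.Iio M))) :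
    ∃ y ∈ pushSubgroup s t M, ∃ x ∈ Subgroup.closure (s '' Set.Iio M), g = y * x := by
  have ht : t ∈ pushSubgroup s t M := by
    simpa [pushElt_of_le s t le_rfl] using pushElt_mem s t M M
  induction hg using Subgroup.closure_induction_left with
  | one => exact ⟨1, one_mem _, 1, one_mem _, by simp⟩
  | mul_left a ha g _ ih =>
    obtain ⟨y, hy, x, hx, rfl⟩ := ih
    rcases ha with rfl | ⟨i, hi, rfl⟩
    · exact ⟨a * y, mul_mem ht hy, x, hx, by group⟩
    · exact ⟨_, (h.conj_mem_pushSubgroup hi hy).1, s i * x,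
        mul_mem (Subgroup.subset_closure ⟨i, hi, rfl⟩) hx, by group⟩
  | inv_mul_cancel a ha g _ ih =>
    obtain ⟨y, hy, x, hx, rfl⟩ := ih
    rcases ha with rfl | ⟨i, hi, rfl⟩
    · exact ⟨a⁻¹ * y, mul_mem (inv_mem ht) hy, x, hx, by group⟩
    · exact ⟨_, (h.conj_mem_pushSubgroup hi hy).2, (s i)⁻¹ * x,
        mul_mem (inv_mem (Subgroup.subset_closure ⟨i, hi, rfl⟩)) hx, by group⟩

end IsTypeB

end Push

namespace FreeGroup

/-- The endomorphism of the free group killing the generator `b`. -/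
def killGen (b : ℕ) : FreeGroup ℕ →* FreeGroup ℕ := lift fun k => if k = b then 1 else of k

@[simp] lemma killGen_of_self (b : ℕ) : killGen b (of b) = 1 := by simp [killGen]

lemma killGen_of_ne {b k : ℕ} (h : k ≠ b) : killGen b (of k) = of k := by simp [killGen, h]

lemma killGen_artinAut {i b : ℕ} (h : i + 1 < b) (g : FreeGroup ℕ) :
    killGen b (artinAut i g) = artinAut i (killGen b g) := by
  have : (killGen b).comp (artinAut i).toMonoidHom =
      (artinAut i).toMonoidHom.comp (killGen b) := by
    ext k
    simp only [MonoidHom.comp_apply, MulEquiv.toMonoidHom_eq_coe, MonoidHom.coe_coe]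
    have e₁ := killGen_of_ne (b := b) (k := i) (by omega)
    have e₂ := killGen_of_ne (b := b) (k := i + 1) (by omega)
    rcases eq_or_ne k i with rfl | h₁
    · simp [e₁, e₂]
    rcases eq_or_ne k (i + 1) with rfl | h₂
    · simp [e₁, e₂]
    rw [artinAut_of_ne h₁ h₂]
    rcases eq_or_ne k b with rfl | h₃
    · simp
    · rw [killGen_of_ne h₃, artinAut_of_ne h₁ h₂]
  exact DFunLike.congr_fun this g

/-- An action of the free group detecting whether `killGen b` vanishes: generators other than `b`
translate the first coordinate, and `b` shifts the second one over the identity. -/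
noncomputable def detect (b : ℕ) : FreeGroup ℕ →* Equiv.Perm (FreeGroup ℕ × ℤ) :=
  open Classical in
  lift fun k =>
    if k = b then
      { toFun := fun p => (p.1, if p.1 = 1 then p.2 + 1 else p.2)
        invFun := fun p => (p.1, if p.1 = 1 then p.2 - 1 else p.2)
        left_inv := fun p => by by_cases h : p.1 = 1 <;> simp [h, Prod.ext_iff]
        right_inv := fun p => by by_cases h : p.1 = 1 <;> simp [h, Prod.ext_iff] }
    else
      { toFun := fun p => (of k * p.1, p.2)
        invFun := fun p => ((of k)⁻¹ * p.1, p.2)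
        left_inv := fun p => by simp
        right_inv := fun p => by simp }

lemma detect_apply (b : ℕ) (w : FreeGroup ℕ) : ∀ g : FreeGroup ℕ,
    ∃ c, ∀ n, detect b w (g, n) = (killGen b w * g, n + c) := by
  induction w using FreeGroup.induction_on with
  | C1 => exact fun g => ⟨0, fun n => by simp⟩
  | of k =>
    intro g
    rcases eq_or_ne k b with rfl | h
    · by_cases hg : g = 1
      · exact ⟨1, fun n => by simp [detect, hg]⟩
      · exact ⟨0, fun n => by simp [detect, hg]⟩
    · exact ⟨0, fun n => by simp [detect, h, killGen_of_ne h]⟩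
  | inv_of k _ =>
    intro g
    rcases eq_or_ne k b with rfl | h
    · by_cases hg : g = 1
      · exact ⟨-1, fun n => by
          rw [_root_.map_inv, Equiv.Perm.inv_eq_iff_eq]; simp [detect, hg]⟩
      · exact ⟨0, fun n => by
          rw [_root_.map_inv, Equiv.Perm.inv_eq_iff_eq]; simp [detect, hg]⟩
    · exact ⟨0, fun n => by
        rw [_root_.map_inv, Equiv.Perm.inv_eq_iff_eq]; simp [detect, h, killGen_of_ne h]⟩
  | mul x y hx hy =>
    intro g
    obtain ⟨c, hc⟩ := hy g
    obtain ⟨d, hd⟩ := hx (killGen b y * g)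
    refine ⟨c + d, fun n => ?_⟩
    rw [_root_.map_mul, Equiv.Perm.mul_apply, hc, hd, _root_.map_mul, mul_assoc, add_assoc]

lemma killGen_eq_one_of_commute {b : ℕ} {w : FreeGroup ℕ} (h : Commute w (of b)) :
    killGen b w = 1 := by
  by_contra hne
  have key := DFunLike.congr_fun (congrArg (detect b) h.eq) (1, 0)
  obtain ⟨c, hc⟩ := detect_apply b w 1
  have e₁ : ∀ n, detect b (of b) (1, n) = (1, n + 1) := fun n => by simp [detect]
  have e₂ : ∀ n, detect b (of b) (killGen b w, n) = (killGen b w, n) := fun n => by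
    simp [detect, hne]
  simp only [_root_.map_mul, Equiv.Perm.mul_apply, e₁, hc, mul_one, e₂, Prod.mk.injEq] at key
  omega

end FreeGroup

section Faithful

open FreeGroup

variable {G : Type*} [Group G] {s : ℕ → G} {t : G} {M : ℕ}

lemma map_pushElt (ρ : G →* MulAut (FreeGroup ℕ)) (hs : ∀ i < M, ρ (s i) = artinAut i)
    (ht : ρ t = artinAut M ^ 2) {j : ℕ} (hj : j ≤ M) :
    ρ (pushElt s t M j) (of (M + 1)) = of j * of (M + 1) * (of j)⁻¹ ∧
      ∀ g, killGen (M + 1) (ρ (pushElt s t M j) g) = killGen (M + 1) g := by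
  induction hj using Nat.decreasingInduction with
  | self =>
    rw [pushElt_of_le s t le_rfl, ht, pow_two]
    refine ⟨by simp, fun g => ?_⟩
    have : (killGen (M + 1)).comp (artinAut M * artinAut M).toMonoidHom = killGen (M + 1) := by
      ext k
      simp only [MonoidHom.comp_apply, MulEquiv.toMonoidHom_eq_coe, MonoidHom.coe_coe,
        MulAut.mul_apply]
      rcases eq_or_ne k M with rfl | h₁
      · simp
      rcases eq_or_ne k (M + 1) with rfl | h₂
      · simp
      rw [artinAut_of_ne h₁ h₂, artinAut_of_ne h₁ h₂]
    exact DFunLike.congr_fun this g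
  | of_succ j hj ih =>
    have hb : artinAut j (of (M + 1)) = of (M + 1) := artinAut_of_ne (by omega) (by omega)
    have hb' : (artinAut j)⁻¹ (of (M + 1)) = of (M + 1) := by
      rw [MulAut.inv_apply, MulEquiv.symm_apply_eq, hb]
    simp only [pushElt_of_lt s t hj, _root_.map_mul, _root_.map_inv, hs j hj, MulAut.mul_apply]
    refine ⟨?_, fun g => ?_⟩
    · rw [hb', ih.1]
      simp [hb]
    · rw [killGen_artinAut (by omega), ih.2, ← killGen_artinAut (by omega), ← MulAut.mul_apply,
        mul_inv_cancel, MulAut.one_apply]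

lemma exists_conj_of_mem_pushSubgroup (ρ : G →* MulAut (FreeGroup ℕ))
    (hs : ∀ i < M, ρ (s i) = artinAut i) (ht : ρ t = artinAut M ^ 2) {y : G}
    (hy : y ∈ IsTypeB.pushSubgroup s t M) :
    (∃ w, ρ y (of (M + 1)) = w * of (M + 1) * w⁻¹ ∧
      (lift (fun k => (pushElt s t M k)⁻¹) (killGen (M + 1) w))⁻¹ = y) ∧
      ∀ g, killGen (M + 1) (ρ y g) = killGen (M + 1) g := by
  induction hy using Subgroup.closure_induction with
  | mem _ hx =>
    obtain ⟨j, rfl⟩ := hx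
    wlog hj : j ≤ M generalizing j
    · rw [(pushElt_of_le s t (by omega)).trans (pushElt_of_le s t (le_refl M)).symm]
      exact this M le_rfl
    obtain ⟨h₁, h₂⟩ := map_pushElt ρ hs ht hj
    exact ⟨⟨of j, h₁, by rw [killGen_of_ne (by omega)]; simp⟩, h₂⟩
  | one => exact ⟨⟨1, by simp, by simp⟩, by simp⟩
  | mul x y _ _ hx hy =>
    obtain ⟨⟨v, hv, ev⟩, kx⟩ := hx
    obtain ⟨⟨w, hw, ew⟩, ky⟩ := hy
    refine ⟨⟨ρ x w * v, ?_, ?_⟩, fun g => ?_⟩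
    · rw [_root_.map_mul, MulAut.mul_apply, hw]
      simp only [_root_.map_mul, _root_.map_inv, hv]
      group
    · rw [_root_.map_mul, kx, _root_.map_mul, mul_inv_rev, ev, ew]
    · rw [_root_.map_mul, MulAut.mul_apply, kx, ky]
  | inv x _ hx =>
    obtain ⟨⟨v, hv, ev⟩, kx⟩ := hx
    have kx' : ∀ g, killGen (M + 1) ((ρ x)⁻¹ g) = killGen (M + 1) g := fun g => by
      rw [← kx ((ρ x)⁻¹ g), ← MulAut.mul_apply, mul_inv_cancel, MulAut.one_apply]
    refine ⟨⟨((ρ x)⁻¹ v)⁻¹, ?_, ?_⟩, fun g => ?_⟩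
    · have := congrArg (fun z => (ρ x)⁻¹ z) hv
      simp only [← MulAut.mul_apply, inv_mul_cancel, MulAut.one_apply] at this
      rw [_root_.map_mul, _root_.map_mul, _root_.map_inv] at this
      rw [_root_.map_inv]
      generalize (ρ x)⁻¹ (of (M + 1)) = c at *
      rw [this]
      group
    · rw [_root_.map_inv, kx', _root_.map_inv, ev]
    · rw [_root_.map_inv, kx']

theorem IsTypeB.faithful (h : IsTypeB s t M) (ρ : G →* MulAut (FreeGroup ℕ))
    (hs : ∀ i < M, ρ (s i) = artinAut i) (ht : ρ t = artinAut M ^ 2)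
    (hbr : ∀ x ∈ Subgroup.closure (s '' Set.Iio M), ρ x = 1 → x = 1)
    {g : G} (hg : g ∈ Subgroup.closure (insert t (s '' Set.Iio M))) (h1 : ρ g = 1) : g = 1 := by
  obtain ⟨y, hy, x, hx, rfl⟩ := h.exists_eq_mul hg
  obtain ⟨⟨w, hw, ew⟩, ky⟩ := exists_conj_of_mem_pushSubgroup ρ hs ht hy
  have hx' : ρ x (of (M + 1)) = of (M + 1) ∧
      ∀ g, killGen (M + 1) (ρ x g) = ρ x (killGen (M + 1) g) := by
    clear h1 hbr hg
    have hb : ∀ j < M, artinAut j (of (M + 1)) = of (M + 1) :=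
      fun j hj => artinAut_of_ne (by omega) (by omega)
    induction hx using Subgroup.closure_induction with
    | mem _ hx =>
      obtain ⟨i, hi, rfl⟩ := hx
      rw [hs i hi]
      exact ⟨hb i hi, killGen_artinAut (Nat.succ_lt_succ hi)⟩
    | one => simp
    | mul a b _ _ ha hb =>
      simp only [_root_.map_mul, MulAut.mul_apply, hb.1, ha.1, ha.2, hb.2, true_and,
        implies_true]
    | inv a _ ha =>
      rw [_root_.map_inv]
      refine ⟨by rw [MulAut.inv_apply, MulEquiv.symm_apply_eq, ha.1], fun g => ?_⟩
      simp only [MulAut.inv_apply]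
      rw [eq_comm, MulEquiv.symm_apply_eq, ← ha.2, MulEquiv.apply_symm_apply]
  have hρx : ρ x = 1 := by
    apply mulAut_ext
    intro k
    rcases eq_or_ne k (M + 1) with rfl | hk
    · simpa using hx'.1
    · have := ky (ρ x (of k))
      rw [← MulAut.mul_apply, ← _root_.map_mul, h1, MulAut.one_apply, hx'.2,
        killGen_of_ne hk] at this
      simpa using this.symm
  have hx1 := hbr x hx hρx
  subst hx1
  rw [mul_one] at h1 ⊢
  rw [h1, MulAut.one_apply, eq_mul_inv_iff_mul_eq] at hw
  rw [killGen_eq_one_of_commute hw.symm] at ew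
  simpa using ew.symm

end Faithful

namespace FreeGroup

/-- The exponent sum of the generator `b`. -/
def countGen (b : ℕ) : FreeGroup ℕ →* Multiplicative ℤ :=
  lift fun k => if k = b then Multiplicative.ofAdd 1 else 1

@[simp] lemma countGen_of_self (b : ℕ) : countGen b (of b) = Multiplicative.ofAdd 1 := by
  simp [countGen]

lemma countGen_of_ne {b k : ℕ} (h : k ≠ b) : countGen b (of k) = 1 := by simp [countGen, h]

lemma countGen_artinAut {i b : ℕ} (h : i + 1 < b) (g : FreeGroup ℕ) :
    countGen b (artinAut i g) = countGen b g := by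
  have : (countGen b).comp (artinAut i).toMonoidHom = countGen b := by
    ext1 k
    simp only [MonoidHom.comp_apply, MulEquiv.toMonoidHom_eq_coe, MonoidHom.coe_coe]
    have e₁ := countGen_of_ne (b := b) (k := i) (by omega)
    have e₂ := countGen_of_ne (b := b) (k := i + 1) (by omega)
    rcases eq_or_ne k i with rfl | h₁
    · simp [e₁, e₂]
    rcases eq_or_ne k (i + 1) with rfl | h₂
    · simp [e₁, e₂]
    rw [artinAut_of_ne h₁ h₂]
  exact DFunLike.congr_fun this g

lemma countGen_artinAut_artinAut (i : ℕ) (g : FreeGroup ℕ) :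
    countGen (i + 1) (artinAut i (artinAut i g)) = countGen (i + 1) g := by
  have : (countGen (i + 1)).comp (artinAut i * artinAut i).toMonoidHom = countGen (i + 1) := by
    ext1 k
    simp only [MonoidHom.comp_apply, MulEquiv.toMonoidHom_eq_coe, MonoidHom.coe_coe,
      MulAut.mul_apply]
    rcases eq_or_ne k i with rfl | h₁
    · simp
    rcases eq_or_ne k (i + 1) with rfl | h₂
    · simp
    rw [artinAut_of_ne h₁ h₂, artinAut_of_ne h₁ h₂]
  exact DFunLike.congr_fun this g

end FreeGroup

section Coset

variable {G : Type*} [Group G]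

/-- The product `s M * s (M - 1) * ⋯ * s j`. -/
def descProd (s : ℕ → G) (M : ℕ) (j : ℕ) : G :=
  if j ≤ M then descProd s M (j + 1) * s j else 1
termination_by M + 1 - j

lemma descProd_of_le (s : ℕ → G) {M j : ℕ} (h : j ≤ M) :
    descProd s M j = descProd s M (j + 1) * s j := by
  rw [descProd, if_pos h]

lemma descProd_of_gt (s : ℕ → G) {M j : ℕ} (h : M < j) : descProd s M j = 1 := by
  rw [descProd, if_neg (by omega)]

namespace IsBraid

variable {s : ℕ → G} {M : ℕ}

lemma commute_descProd (h : IsBraid s (M + 1)) {i j : ℕ} (hij : i + 1 < j) (hj : j ≤ M + 1) :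
    Commute (s i) (descProd s M j) := by
  induction hj using Nat.decreasingInduction with
  | self => rw [descProd_of_gt s (by omega)]; exact Commute.one_right _
  | of_succ j hj ih =>
    rw [descProd_of_le s (by omega)]
    exact (ih (by omega)).mul_right (h.comm i j hij hj)

lemma semiconjBy_descProd (h : IsBraid s (M + 1)) {j k : ℕ} (hjk : j ≤ k) (hk : k + 1 ≤ M) :
    SemiconjBy (descProd s M j) (s (k + 1)) (s k) := by
  induction hjk using Nat.decreasingInduction with
  | self =>
    rw [descProd_of_le s (by omega), descProd_of_le s hk, mul_assoc]
    refine SemiconjBy.mul_left (h.commute_descProd (by omega) (by omega)).symm ?_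
    rw [SemiconjBy, ← h.braid k (by omega), mul_assoc]
  | of_succ j hj ih =>
    rw [descProd_of_le s (by omega)]
    exact ih.mul_left (h.comm j (k + 1) (by omega) (by omega))

lemma conj_sq_mem (h : IsBraid s (M + 1)) {j : ℕ} (hj : j ≤ M) :
    descProd s M (j + 1) * s j ^ 2 * (descProd s M (j + 1))⁻¹ ∈
      Subgroup.closure (insert (s M ^ 2) (s '' Set.Iio M)) := by
  induction hj using Nat.decreasingInduction with
  | self =>
    rw [descProd_of_gt s (by omega)]
    simpa using Subgroup.subset_closure (Set.mem_insert _ _)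
  | of_succ j hj ih =>
    have hs : s j ∈ Subgroup.closure (insert (s M ^ 2) (s '' Set.Iio M)) :=
      Subgroup.subset_closure (Set.mem_insert_of_mem _ ⟨j, hj, rfl⟩)
    have hc := h.commute_descProd (i := j) (j := j + 1 + 1) (by omega) (by omega)
    have hb := h.braid j (by omega)
    rw [descProd_of_le s (show j + 1 ≤ M by omega)]
    generalize descProd s M (j + 1 + 1) = c at *
    have e : s (j + 1) * s j ^ 2 * (s (j + 1))⁻¹ = (s j)⁻¹ * s (j + 1) ^ 2 * s j := by
      rw [mul_inv_eq_iff_eq_mul, mul_assoc, mul_assoc, eq_inv_mul_iff_mul_eq, pow_two, pow_two]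
      calc s j * (s (j + 1) * (s j * s j)) = s j * s (j + 1) * s j * s j := by group
        _ = s (j + 1) * s j * s (j + 1) * s j := by rw [hb]
        _ = s (j + 1) * (s j * s (j + 1) * s j) := by group
        _ = s (j + 1) * (s (j + 1) * s j * s (j + 1)) := by rw [hb]
        _ = _ := by group
    have e' : c * s (j + 1) * s j ^ 2 * (c * s (j + 1))⁻¹ =
        (s j)⁻¹ * (c * s (j + 1) ^ 2 * c⁻¹) * s j := by
      calc _ = c * (s (j + 1) * s j ^ 2 * (s (j + 1))⁻¹) * c⁻¹ := by group
        _ = c * (s j)⁻¹ * s (j + 1) ^ 2 * (s j * c⁻¹) := by rw [e]; group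
        _ = (s j)⁻¹ * c * s (j + 1) ^ 2 * (c⁻¹ * s j) := by
          rw [hc.inv_right.eq, hc.symm.inv_right.eq]
        _ = _ := by group
    rw [e']
    exact mul_mem (mul_mem (inv_mem hs) ih) hs

lemma isTypeB (h : IsBraid s (M + 1)) : IsTypeB s (s M ^ 2) M where
  comm i j hij hj := h.comm i j hij (by omega)
  braid i hi := h.braid i (by omega)
  comm_last i hi := (h.comm i M hi (by omega)).pow_right 2
  braid_last i hi := by
    subst hi
    have hb := h.braid i (by omega)
    generalize s i = a at *
    generalize s (i + 1) = b at *
    rw [pow_two]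
    calc a * (b * b) * a * (b * b) = a * b * (b * a * b) * b := by group
      _ = a * b * (a * b * a) * b := by rw [hb]
      _ = (a * b * a) * (b * a * b) := by group
      _ = (b * a * b) * (a * b * a) := by rw [hb]
      _ = b * (a * b * a) * b * a := by group
      _ = b * (b * a * b) * b * a := by rw [hb]
      _ = _ := by group

lemma exists_eq_mul_descProd (h : IsBraid s (M + 1)) {g : G}
    (hg : g ∈ Subgroup.closure (s '' Set.Iio (M + 1))) :
    ∃ a ∈ Subgroup.closure (insert (s M ^ 2) (s '' Set.Iio M)), ∃ j ≤ M + 1,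
      g = a * descProd s M j := by
  have hs : ∀ i < M, s i ∈ Subgroup.closure (insert (s M ^ 2) (s '' Set.Iio M)) := fun i hi =>
    Subgroup.subset_closure (Set.mem_insert_of_mem _ ⟨i, hi, rfl⟩)
  have slide : ∀ i < M + 1, ∀ j ≤ M + 1, i + 1 ≠ j → i ≠ j →
      ∃ k < M, SemiconjBy (descProd s M j) (s i) (s k) := by
    intro i hi j hj h₁ h₂
    rcases Nat.lt_or_ge i j with hij | hij
    · exact ⟨i, by omega, (h.commute_descProd (by omega) hj).symm⟩
    · obtain ⟨k, rfl⟩ : ∃ k, i = k + 1 := ⟨i - 1, by omega⟩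
      exact ⟨k, by omega, h.semiconjBy_descProd (by omega) (by omega)⟩
  induction hg using Subgroup.closure_induction_right with
  | one => exact ⟨1, one_mem _, M + 1, le_rfl, by rw [descProd_of_gt s (by omega), mul_one]⟩
  | mul_right g _ x hx ih =>
    obtain ⟨a, ha, j, hj, rfl⟩ := ih
    obtain ⟨i, hi, rfl⟩ := hx
    rw [Set.mem_Iio] at hi
    rcases eq_or_ne (i + 1) j with rfl | h₁
    · exact ⟨a, ha, i, by omega, by rw [descProd_of_le s (show i ≤ M by omega), mul_assoc]⟩
    rcases eq_or_ne i j with rfl | h₂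
    · refine ⟨_, mul_mem ha (h.conj_sq_mem (j := i) (by omega)), i + 1, hi, ?_⟩
      rw [descProd_of_le s (show i ≤ M by omega), pow_two]
      group
    · obtain ⟨k, hk, e⟩ := slide i hi j hj h₁ h₂
      exact ⟨a * s k, mul_mem ha (hs k hk), j, hj, by rw [mul_assoc, e.eq, mul_assoc]⟩
  | mul_inv_cancel g _ x hx ih =>
    obtain ⟨a, ha, j, hj, rfl⟩ := ih
    obtain ⟨i, hi, rfl⟩ := hx
    rw [Set.mem_Iio] at hi
    rcases eq_or_ne i j with rfl | h₂
    · exact ⟨a, ha, i + 1, hi, by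
        rw [descProd_of_le s (show i ≤ M by omega), mul_assoc, mul_inv_cancel_right]⟩
    rcases eq_or_ne (i + 1) j with rfl | h₁
    · refine ⟨_, mul_mem ha (inv_mem (h.conj_sq_mem (j := i) (by omega))), i, by omega, ?_⟩
      rw [descProd_of_le s (show i ≤ M by omega)]
      group
    · obtain ⟨k, hk, e⟩ := slide i hi j hj h₁ h₂
      exact ⟨a * (s k)⁻¹, mul_mem ha (inv_mem (hs k hk)), j, hj, by
        rw [mul_assoc, e.inv_right.eq, mul_assoc]⟩

open FreeGroup

lemma countGen_map_descProd (ρ : G →* MulAut (FreeGroup ℕ))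
    (hs : ∀ i < M + 1, ρ (s i) = artinAut i) {j : ℕ} (hj : j ≤ M + 1) :
    countGen (M + 1) (ρ (descProd s M j) (of j)) = Multiplicative.ofAdd 1 := by
  induction hj using Nat.decreasingInduction with
  | self => rw [descProd_of_gt s (by omega)]; simp
  | of_succ j hj ih =>
    rw [descProd_of_le s (by omega), _root_.map_mul, MulAut.mul_apply, hs j hj]
    simp [ih]

lemma countGen_map (ρ : G →* MulAut (FreeGroup ℕ))
    (hs : ∀ i < M + 1, ρ (s i) = artinAut i) {a : G}
    (ha : a ∈ Subgroup.closure (insert (s M ^ 2) (s '' Set.Iio M))) (g : FreeGroup ℕ) :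
    countGen (M + 1) (ρ a g) = countGen (M + 1) g := by
  induction ha using Subgroup.closure_induction generalizing g with
  | mem _ hx =>
    rcases hx with rfl | ⟨i, hi, rfl⟩
    · rw [_root_.map_pow, hs M (by omega), pow_two, MulAut.mul_apply, countGen_artinAut_artinAut]
    · rw [Set.mem_Iio] at hi
      rw [hs i (by omega), countGen_artinAut (by omega)]
  | one => simp
  | mul x y _ _ hx hy => rw [_root_.map_mul, MulAut.mul_apply, hx, hy]
  | inv x _ hx =>
    rw [_root_.map_inv, ← hx ((ρ x)⁻¹ g), ← MulAut.mul_apply, mul_inv_cancel, MulAut.one_apply]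

theorem faithful (ρ : G →* MulAut (FreeGroup ℕ)) (h : IsBraid s M)
    (hs : ∀ i < M, ρ (s i) = artinAut i) {g : G}
    (hg : g ∈ Subgroup.closure (s '' Set.Iio M)) (h1 : ρ g = 1) : g = 1 := by
  induction M generalizing g with
  | zero => simpa using hg
  | succ M ih =>
    obtain ⟨a, ha, j, hj, rfl⟩ := h.exists_eq_mul_descProd hg
    have key : countGen (M + 1) (of j) = Multiplicative.ofAdd 1 := by
      rw [← countGen_map_descProd ρ hs hj, ← countGen_map ρ hs ha (ρ _ _), ← MulAut.mul_apply,
        ← _root_.map_mul, h1, MulAut.one_apply]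
    obtain rfl : j = M + 1 := by
      by_contra hne
      rw [countGen_of_ne hne] at key
      exact absurd key (by decide)
    rw [descProd_of_gt s (by omega), mul_one] at h1 ⊢
    have hs' : ∀ i < M, ρ (s i) = artinAut i := fun i hi => hs i (by omega)
    have hB := h.isTypeB
    exact hB.faithful ρ hs' (by rw [_root_.map_pow, hs M (by omega)])
      (fun x hx hx1 => ih hB.toIsBraid hs' hx hx1) ha h1

end IsBraid

end Coset

section Presentation

variable {B H : Type*} [Group H] {m : B → B → ℕ}

/-- The homomorphism from an Artin group determined by a map satisfying the Artin relations. -/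
def artinLift (f : B → H) (hf : ∀ i j, i ≠ j →
    FreeGroup.lift f (artinWord (m i j) i j) = FreeGroup.lift f (artinWord (m i j) j i)) :
    ArtinGroup m →* H :=
  PresentedGroup.toGroup (f := f) (rels := artinRels m) (by
    rintro _ ⟨i, j, hij, _, rfl⟩
    rw [map_mul, map_inv, hf i j hij, mul_inv_cancel])

lemma artinLift_artinGen (f : B → H) (hf) (i : B) :
    artinLift (m := m) f hf (artinGen m i) = f i :=
  PresentedGroup.toGroup.of _

lemma lift_artinGen_artinWord {i j : B} (hij : i ≠ j) (hm : m i j ≠ 0) :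
    FreeGroup.lift (artinGen m) (artinWord (m i j) i j) =
      FreeGroup.lift (artinGen m) (artinWord (m i j) j i) := by
  have e : FreeGroup.lift (artinGen m) = PresentedGroup.mk (artinRels m) := by
    ext k; exact FreeGroup.lift_apply_of
  rw [← mul_inv_eq_one, ← map_inv, ← map_mul, e]
  exact PresentedGroup.one_of_mem ⟨i, j, hij, hm, rfl⟩

lemma closure_range_artinGen : Subgroup.closure (Set.range (artinGen m)) = ⊤ :=
  PresentedGroup.closure_range_of (artinRels m)

end Presentation

section TypeB

variable {M : ℕ}

lemma BTypeMatrix_symm {n : ℕ} (i j : Fin n) : BTypeMatrix n i j = BTypeMatrix n j i := by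
  unfold BTypeMatrix
  simp only [eq_comm (a := i) (b := j), or_comm]

lemma BTypeMatrix_of_lt {i j : Fin (M + 1)} (h : i < j) : BTypeMatrix (M + 1) i j =
    if (i : ℕ) + 1 = j then if (j : ℕ) = M then 4 else 3 else 2 := by
  have h' : (i : ℕ) < j := h
  unfold BTypeMatrix
  rw [if_neg h.ne]
  split_ifs <;> omega

/-- The sequence of the Artin generators of type `B`. -/
def artinSeq (M i : ℕ) : ArtinGroup (BTypeMatrix (M + 1)) :=
  if h : i < M + 1 then artinGen _ ⟨i, h⟩ else 1

lemma artinSeq_of_lt {i : ℕ} (h : i < M + 1) : artinSeq M i = artinGen _ ⟨i, h⟩ := dif_pos h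

lemma isTypeB_artinSeq (M : ℕ) : IsTypeB (artinSeq M) (artinSeq M M) M := by
  have comm : ∀ i j, i + 1 < j → j ≤ M → Commute (artinSeq M i) (artinSeq M j) := by
    intro i j hij hj
    rw [artinSeq_of_lt (by omega), artinSeq_of_lt (by omega)]
    have hlt : (⟨i, by omega⟩ : Fin (M + 1)) < ⟨j, by omega⟩ := Fin.mk_lt_mk.2 (by omega)
    have hm := BTypeMatrix_of_lt hlt
    rw [if_neg (by simp; omega)] at hm
    have := lift_artinGen_artinWord (m := BTypeMatrix (M + 1)) hlt.ne (by omega)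
    rw [hm] at this
    simpa [artinWord, commute_iff_eq] using this
  refine ⟨⟨fun i j hij hj => comm i j hij hj.le, fun i hi => ?_⟩,
    fun i hi => comm i M hi le_rfl, fun i hi => ?_⟩
  · rw [artinSeq_of_lt (by omega), artinSeq_of_lt (by omega)]
    have hlt : (⟨i, by omega⟩ : Fin (M + 1)) < ⟨i + 1, by omega⟩ := Fin.mk_lt_mk.2 (by omega)
    have hm := BTypeMatrix_of_lt hlt
    rw [if_pos rfl, if_neg hi.ne] at hm
    have := lift_artinGen_artinWord (m := BTypeMatrix (M + 1)) hlt.ne (by omega)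
    rw [hm] at this
    simpa [artinWord, mul_assoc] using this
  · subst hi
    rw [artinSeq_of_lt (by omega), artinSeq_of_lt (by omega)]
    have hlt : (⟨i, by omega⟩ : Fin (i + 1 + 1)) < ⟨i + 1, by omega⟩ := Fin.mk_lt_mk.2 (by omega)
    have hm := BTypeMatrix_of_lt hlt
    rw [if_pos rfl, if_pos rfl] at hm
    have := lift_artinGen_artinWord (m := BTypeMatrix (i + 1 + 1)) hlt.ne (by omega)
    rw [hm] at this
    simpa [artinWord, mul_assoc] using this

lemma closure_artinSeq (M : ℕ) :
    Subgroup.closure (insert (artinSeq M M) (artinSeq M '' Set.Iio M)) = ⊤ := by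
  rw [← top_le_iff, ← closure_range_artinGen]
  apply Subgroup.closure_mono
  rintro _ ⟨⟨i, hi⟩, rfl⟩
  rw [← artinSeq_of_lt hi]
  rcases (Nat.lt_succ_iff.1 hi).eq_or_lt with rfl | h
  · exact Set.mem_insert _ _
  · exact Set.mem_insert_of_mem _ ⟨i, h, rfl⟩

namespace IsTypeB

variable {H : Type*} [Group H] {s : ℕ → H} {t : H}

lemma lift_artinWord (h : IsTypeB s t M) (i j : Fin (M + 1)) (hij : i ≠ j) :
    FreeGroup.lift (fun k : Fin (M + 1) => if (k : ℕ) < M then s k else t)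
        (artinWord (BTypeMatrix (M + 1) i j) i j) =
      FreeGroup.lift (fun k : Fin (M + 1) => if (k : ℕ) < M then s k else t)
        (artinWord (BTypeMatrix (M + 1) i j) j i) := by
  wlog hlt : i < j generalizing i j
  · rw [BTypeMatrix_symm i j]
    exact (this j i hij.symm (lt_of_le_of_ne (not_lt.1 hlt) hij.symm)).symm
  rw [BTypeMatrix_of_lt hlt]
  obtain ⟨i, hi⟩ := i
  obtain ⟨j, hj⟩ := j
  rw [Fin.mk_lt_mk] at hlt
  have hiM : i < M := by omega
  rcases (Nat.succ_le_of_lt hlt).eq_or_lt with rfl | hlt'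
  · rcases (Nat.lt_succ_iff.1 hj).eq_or_lt with rfl | hjM
    · simpa [artinWord, mul_assoc] using h.braid_last i rfl
    · simpa [artinWord, mul_assoc, hiM, hjM, hjM.ne] using h.braid i hjM
  · rcases (Nat.lt_succ_iff.1 hj).eq_or_lt with rfl | hjM
    · simpa [artinWord, hiM, hlt'.ne] using (h.comm_last i hlt').eq
    · simpa [artinWord, hiM, hjM, hlt'.ne] using (h.comm i j hlt' hjM).eq

/-- The homomorphism from the Artin group of type `B` determined by a solution of its relations. -/
def hom (h : IsTypeB s t M) : ArtinGroup (BTypeMatrix (M + 1)) →* H :=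
  artinLift _ h.lift_artinWord

lemma hom_artinGen (h : IsTypeB s t M) (i : Fin (M + 1)) :
    h.hom (artinGen _ i) = if (i : ℕ) < M then s i else t :=
  artinLift_artinGen _ _ _

end IsTypeB

open FreeGroup

lemma isBraid_artinAut (M : ℕ) : IsBraid artinAut M :=
  ⟨fun _ _ hij _ => artinAut_comm hij, fun i _ => artinAut_braid i⟩

/-- The action of the Artin group of type `B` on the free group. -/
def artinAction (M : ℕ) : ArtinGroup (BTypeMatrix (M + 1)) →* MulAut (FreeGroup ℕ) :=
  (isBraid_artinAut (M + 1)).isTypeB.hom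

lemma artinAction_injective (M : ℕ) : Function.Injective (artinAction M) := by
  have hs : ∀ i < M, artinAction M (artinSeq M i) = artinAut i := fun i hi => by
    rw [artinSeq_of_lt (by omega), artinAction, IsTypeB.hom_artinGen, if_pos hi]
  have ht : artinAction M (artinSeq M M) = artinAut M ^ 2 := by
    rw [artinSeq_of_lt (by omega), artinAction, IsTypeB.hom_artinGen, if_neg (lt_irrefl M)]
  rw [injective_iff_map_eq_one]
  intro g hg
  have hB := isTypeB_artinSeq M
  exact hB.faithful _ hs ht (fun x hx hx1 => hB.toIsBraid.faithful _ hs hx hx1)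
    (by rw [closure_artinSeq]; trivial) hg

lemma artinAction_mem_cycAut (M : ℕ) (a : ArtinGroup (BTypeMatrix (M + 1))) :
    artinAction M a ∈ cycAut := by
  have : Subgroup.closure (Set.range (artinGen _)) ≤ cycAut.comap (artinAction M) := by
    refine (Subgroup.closure_le _).2 ?_
    rintro _ ⟨i, rfl⟩
    rw [SetLike.mem_coe, Subgroup.mem_comap, artinAction, IsTypeB.hom_artinGen]
    split_ifs
    · exact artinAut_mem_cycAut _
    · exact pow_mem (artinAut_mem_cycAut _) 2
  rw [closure_range_artinGen] at this
  exact this (Subgroup.mem_top a)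

lemma isTypeB_const {H : Type*} [Group H] (a : H) (M : ℕ) : IsTypeB (fun _ => a) a M :=
  ⟨⟨fun _ _ _ _ => Commute.refl a, fun _ _ => rfl⟩, fun _ _ => Commute.refl a, fun _ _ => rfl⟩

/-- The length homomorphism, sending each Artin generator to `1`. -/
def artinLength (M : ℕ) : ArtinGroup (BTypeMatrix (M + 1)) →* Multiplicative ℤ :=
  (isTypeB_const (Multiplicative.ofAdd 1) M).hom

lemma artinLength_artinGen (M : ℕ) (i : Fin (M + 1)) :
    artinLength M (artinGen _ i) = Multiplicative.ofAdd 1 := by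
  rw [artinLength, IsTypeB.hom_artinGen, ite_self]

end TypeB

section Order

open FreeGroup

variable {A : Type*} [Group A]

lemma FreeGroup.Nontriv.map_lt {f : MulAut (FreeGroup ℕ)} (hf : f ∈ cycAut) {u v u' v' : Nontriv}
    (hu : u'.1 = f u.1) (hv : v'.1 = f v.1) : u' < v' ↔ u < v := by
  have := hf 1 u.1 v.1
  rwa [_root_.map_one, ← hu, ← hv] at this

theorem exists_linearOrder_of_cycAut (ρ : A →* MulAut (FreeGroup ℕ))
    (hinj : Function.Injective ρ) (hρ : ∀ a, ρ a ∈ cycAut) (l : A →* Multiplicative ℤ) :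
    ∃ lo : LinearOrder A, (∀ a x y : A, lo.lt x y → lo.lt (a * x) (a * y)) ∧
      ∀ x y : A, l x < l y → lo.lt x y := by
  let φ : A → Lex (ℕ → Nontriv) := fun a =>
    toLex fun k => ⟨ρ a (of k), by simp [of_ne_one]⟩
  let Φ : A → ℤ ×ₗ Lex (ℕ → Nontriv) := fun a => toLex ((l a).toAdd, φ a)
  have hφ : Function.Injective φ := by
    intro a b h
    apply hinj
    apply mulAut_ext
    intro k
    exact congrArg Subtype.val (congrFun h k)
  have hΦ : Function.Injective Φ := fun a b h => hφ (congrArg (fun z => (ofLex z).2) h)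
  have hlt : ∀ a x y, φ x < φ y → φ (a * x) < φ (a * y) := by
    rintro a x y ⟨k, hk, hlt⟩
    have e : ∀ z j, (φ (a * z) j).1 = ρ a (φ z j).1 := fun z j => by
      change ρ (a * z) (of j) = ρ a (ρ z (of j))
      rw [_root_.map_mul, MulAut.mul_apply]
    refine ⟨k, fun j hj => Subtype.ext ?_, (Nontriv.map_lt (hρ a) (e x k) (e y k)).2 hlt⟩
    have := hk j hj
    exact (e x j).trans ((congrArg (fun z : Nontriv => ρ a z.1) this).trans (e y j).symm)
  refine ⟨LinearOrder.lift' Φ hΦ, fun a x y h => ?_, fun x y h => ?_⟩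
  · change Φ x < Φ y at h
    change Φ (a * x) < Φ (a * y)
    rw [Prod.Lex.toLex_lt_toLex] at h ⊢
    simp only [_root_.map_mul, toAdd_mul] at h ⊢
    rcases h with h | ⟨h, h'⟩
    · left; omega
    · right; exact ⟨by omega, hlt a x y h'⟩
  · change Φ x < Φ y
    exact Prod.Lex.toLex_lt_toLex.2 (Or.inl h)

lemma exists_list_prod_of_mem_closure_range {N ι : Type*} [Monoid N] {g : ι → N} {x : N}
    (hx : x ∈ Submonoid.closure (Set.range g)) : ∃ L : List ι, (L.map g).prod = x := by
  induction hx using Submonoid.closure_induction with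
  | mem _ h => obtain ⟨i, rfl⟩ := h; exact ⟨[i], by simp⟩
  | one => exact ⟨[], rfl⟩
  | mul _ _ _ _ h₁ h₂ =>
    obtain ⟨L₁, rfl⟩ := h₁
    obtain ⟨L₂, rfl⟩ := h₂
    exact ⟨L₁ ++ L₂, by simp⟩

theorem exists_least_of_subset_closure {ι : Type*} [Finite ι] (lo : LinearOrder A)
    (l : A →* Multiplicative ℤ) (hl : ∀ x y : A, l x < l y → lo.lt x y) (g : ι → A)
    (hg : ∀ i, l (g i) = Multiplicative.ofAdd 1) {S : Set A}
    (hS : S ⊆ Submonoid.closure (Set.range g)) (hne : S.Nonempty) :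
    ∃ a ∈ S, ∀ x ∈ S, lo.le a x := by
  have hlen : ∀ L : List ι, l (L.map g).prod = Multiplicative.ofAdd (L.length : ℤ) := by
    intro L
    induction L with
    | nil => simp
    | cons i L ih =>
      rw [List.map_cons, List.prod_cons, _root_.map_mul, hg, ih, ← ofAdd_add, List.length_cons]
      push_cast
      rw [add_comm]
  have hex : ∃ k : ℕ, ∃ L : List ι, L.length = k ∧ (L.map g).prod ∈ S := by
    obtain ⟨x, hx⟩ := hne
    obtain ⟨L, rfl⟩ := exists_list_prod_of_mem_closure_range (hS hx)
    exact ⟨_, L, rfl, hx⟩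
  classical
  obtain ⟨L₀, hL₀, hmem⟩ := Nat.find_spec hex
  have hfin : Set.Finite {x ∈ S | l x = l (L₀.map g).prod} := by
    refine ((List.finite_length_eq ι L₀.length).image fun L => (L.map g).prod).subset ?_
    rintro x ⟨hx, hx'⟩
    obtain ⟨L, rfl⟩ := exists_list_prod_of_mem_closure_range (hS hx)
    rw [hlen, hlen] at hx'
    exact ⟨L, by simpa using hx', rfl⟩
  obtain ⟨a, ⟨haS, ha⟩, hmin⟩ := Set.exists_min_image _ id hfin ⟨_, hmem, rfl⟩
  refine ⟨a, haS, fun x hx => ?_⟩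
  rcases eq_or_ne (l x) (l (L₀.map g).prod) with h | h
  · exact hmin x ⟨hx, h⟩
  · refine le_of_lt (hl a x ?_)
    obtain ⟨L, rfl⟩ := exists_list_prod_of_mem_closure_range (hS hx)
    rw [ha]
    refine lt_of_le_of_ne ?_ h.symm
    rw [hlen, hlen, Multiplicative.ofAdd_le, hL₀]
    exact_mod_cast Nat.find_min' hex ⟨L, rfl, hx⟩

end Order

/-- For every `n ≥ 2`, the Artin group of type `B n` admits a left-invariant
linear order whose restriction to the submonoid generated by the Artin generators is a
well-order: every nonempty subset of that submonoid has a least element. -/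
theorem artinB_exists_leftInvariant_order_wellOrdering_positive_monoid
    (n : ℕ) (hn : 2 ≤ n) :
    ∃ lo : LinearOrder (ArtinGroup (BTypeMatrix n)),
      (∀ a x y : ArtinGroup (BTypeMatrix n), lo.lt x y → lo.lt (a * x) (a * y)) ∧
      (∀ S : Set (ArtinGroup (BTypeMatrix n)),
        S ⊆ ↑(Submonoid.closure (Set.range (artinGen (BTypeMatrix n)))) → S.Nonempty →
          ∃ m ∈ S, ∀ x ∈ S, lo.le m x) := by
  obtain ⟨M, rfl⟩ : ∃ M, n = M + 1 := ⟨n - 1, by omega⟩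
  obtain ⟨lo, hlo, hl⟩ := exists_linearOrder_of_cycAut (artinAction M) (artinAction_injective M)
    (artinAction_mem_cycAut M) (artinLength M)
  exact ⟨lo, hlo, fun S hS hne =>
    exists_least_of_subset_closure lo (artinLength M) hl _ (artinLength_artinGen M) hS hne⟩
end

section
/- Let G be a group, N a normal subgroup of G, and φ : G → G an involutive anti-automorphism (φ(x·y) = φ(y)·φ(x), φ∘φ = id) with φ(N) = N. Suppose N carries a left-invariant linear order such that for every v ∈ N, v > 1 if and only if φ(v) > 1, and the quotient group G/N carries a left-invariant linear order such that for every x ∈ G, the coset x·N is > 1 in G/N if and only if the coset φ(x)·N is > 1 in G/N. Then G admits a left-invariant linear order < such that for all x ∈ G, x > 1 if and only if φ(x) > 1. -/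
/-- A positive cone `P` on a group (closed under products, omitting `1`, and containing `x` or `x⁻¹`
for each `x ≠ 1`) is the set of positive elements of a left-invariant linear order. -/
theorem exists_linearOrder_lt_iff_of_positiveCone {G : Type*} [Group G] (P : G → Prop)
    (hone : ¬ P 1) (hmul : ∀ x y, P x → P y → P (x * y))
    (htotal : ∀ x, P x ∨ x = 1 ∨ P x⁻¹) :
    ∃ lo : LinearOrder G, ∀ x y : G, lo.lt x y ↔ P (x⁻¹ * y) := by
  classical
  have htrans : ∀ x y z : G, P (x⁻¹ * y) → P (y⁻¹ * z) → P (x⁻¹ * z) := fun x y z h₁ h₂ => by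
    simpa [mul_assoc] using hmul _ _ h₁ h₂
  have hasymm : ∀ x y : G, P (x⁻¹ * y) → ¬ P (y⁻¹ * x) := fun x y h₁ h₂ =>
    hone (by simpa using htrans _ _ _ h₁ h₂)
  refine ⟨{ le := fun x y => x = y ∨ P (x⁻¹ * y)
            lt := fun x y => P (x⁻¹ * y)
            le_refl := fun x => Or.inl rfl
            le_trans := ?_
            lt_iff_le_not_ge := ?_
            le_antisymm := ?_
            le_total := ?_
            toDecidableLE := Classical.decRel _ }, fun x y => Iff.rfl⟩
  · rintro x y z (rfl | h₁) (rfl | h₂)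
    · exact Or.inl rfl
    · exact Or.inr h₂
    · exact Or.inr h₁
    · exact Or.inr (htrans _ _ _ h₁ h₂)
  · refine fun x y => ⟨fun h => ⟨Or.inr h, ?_⟩, ?_⟩
    · rintro (rfl | h')
      · exact hasymm _ _ h h
      · exact hasymm _ _ h h'
    · rintro ⟨rfl | h, h'⟩
      · exact absurd (Or.inl rfl) h'
      · exact h
  · rintro x y (rfl | h₁) (h | h₂)
    · rfl
    · rfl
    · exact h.symm
    · exact absurd h₂ (hasymm _ _ h₁)
  · intro x y
    rcases htotal (x⁻¹ * y) with h | h | h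
    · exact Or.inl (Or.inr h)
    · exact Or.inl (Or.inl (inv_mul_eq_one.mp h))
    · exact Or.inr (Or.inr (by simpa using h))

/-- Let `N` be a normal subgroup of `G` and `φ` an involutive
anti-automorphism of `G` with `φ(N) = N`.  If `N` has a left-invariant linear order with
`v > 1 ↔ φ v > 1`, and `G/N` has a left-invariant linear order with
`x·N > 1 ↔ φ(x)·N > 1`, then `G` has a left-invariant linear order with `x > 1 ↔ φ x > 1`. -/
theorem exists_leftInvariant_order_compatible_of_extension
    {G : Type*} [Group G] (N : Subgroup G) [N.Normal]
    (φ : G → G)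
    (hmul : ∀ x y : G, φ (x * y) = φ y * φ x)
    (hinv : ∀ x : G, φ (φ x) = x)
    (hN : ∀ x : G, x ∈ N ↔ φ x ∈ N)
    (loN : LinearOrder N)
    (hloN_left : ∀ a x y : N, loN.lt x y → loN.lt (a * x) (a * y))
    (hloN_pos : ∀ v : N, loN.lt 1 v ↔ loN.lt 1 ⟨φ ↑v, (hN ↑v).mp v.2⟩)
    (loQ : LinearOrder (G ⧸ N))
    (hloQ_left : ∀ a x y : G ⧸ N, loQ.lt x y → loQ.lt (a * x) (a * y))
    (hloQ_pos : ∀ x : G,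
      loQ.lt 1 (QuotientGroup.mk x : G ⧸ N) ↔ loQ.lt 1 (QuotientGroup.mk (φ x) : G ⧸ N)) :
    ∃ lo : LinearOrder G,
      (∀ a x y : G, lo.lt x y → lo.lt (a * x) (a * y)) ∧
      (∀ x : G, lo.lt 1 x ↔ lo.lt 1 (φ x)) := by
  have hposN : ∀ x y : N, loN.lt 1 x → loN.lt 1 y → loN.lt 1 (x * y) := fun x y hx hy =>
    @lt_trans _ loN.toPreorder _ _ _ hx (by simpa using hloN_left x 1 y hy)
  have hposQ : ∀ x y : G ⧸ N, loQ.lt 1 x → loQ.lt 1 y → loQ.lt 1 (x * y) := fun x y hx hy =>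
    @lt_trans _ loQ.toPreorder _ _ _ hx (by simpa using hloQ_left x 1 y hy)
  have hex := exists_linearOrder_lt_iff_of_positiveCone
    (fun x : G => loQ.lt 1 (QuotientGroup.mk x : G ⧸ N) ∨ ∃ h : x ∈ N, loN.lt 1 ⟨x, h⟩) ?_ ?_ ?_
  · obtain ⟨lo, hlo⟩ := hex
    refine ⟨lo, fun a x y h => ?_, fun x => ?_⟩
    · rw [hlo] at h ⊢
      simpa [mul_assoc] using h
    · simp only [hlo, inv_one, one_mul]
      refine or_congr (hloQ_pos x) ⟨?_, ?_⟩
      · rintro ⟨h, hx⟩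
        exact ⟨(hN x).mp h, (hloN_pos ⟨x, h⟩).mp hx⟩
      · rintro ⟨h, hx⟩
        exact ⟨(hN x).mpr h, (hloN_pos ⟨x, (hN x).mpr h⟩).mpr hx⟩
  · rintro (h | ⟨_, h⟩)
    · exact @lt_irrefl _ loQ.toPreorder _ h
    · exact @lt_irrefl _ loN.toPreorder _ h
  · rintro x y (hx | ⟨hxN, hx⟩) (hy | ⟨hyN, hy⟩)
    · exact Or.inl (hposQ _ _ hx hy)
    · left
      rwa [QuotientGroup.mk_mul, (QuotientGroup.eq_one_iff y).mpr hyN, mul_one]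
    · left
      rwa [QuotientGroup.mk_mul, (QuotientGroup.eq_one_iff x).mpr hxN, one_mul]
    · exact Or.inr ⟨N.mul_mem hxN hyN, hposN _ _ hx hy⟩
  · intro x
    rcases @lt_trichotomy _ loQ 1 (QuotientGroup.mk x : G ⧸ N) with h | h | h
    · exact Or.inl (Or.inl h)
    · have hx : x ∈ N := (QuotientGroup.eq_one_iff x).mp h.symm
      rcases @lt_trichotomy _ loN 1 ⟨x, hx⟩ with h' | h' | h'
      · exact Or.inl (Or.inr ⟨hx, h'⟩)
      · exact Or.inr (Or.inl (congrArg Subtype.val h').symm)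
      · have := hloN_left ⟨x, hx⟩⁻¹ _ _ h'
        rw [inv_mul_cancel, mul_one] at this
        exact Or.inr (Or.inr (Or.inr ⟨N.inv_mem hx, this⟩))
    · have := hloQ_left (QuotientGroup.mk x)⁻¹ _ _ h
      rw [inv_mul_cancel, mul_one] at this
      exact Or.inr (Or.inr (Or.inl this))
end

section
/- For every type α, the free group F on α admits a left-invariant linear order < such that for all x ∈ F, x > 1 if and only if rev x > 1, where rev : F → F is the involutive anti-automorphism fixing each generator (on a reduced word s_{i₁}^{a₁} ⋯ s_{i_r}^{a_r} it yields s_{i_r}^{a_r} ⋯ s_{i₁}^{a₁}). -/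
/-- The word-reversal anti-automorphism of the free group: the unique anti-automorphism
fixing each generator, realized via the isomorphism `FreeGroup α ≃* (FreeGroup α)ᵐᵒᵖ`
sending `of a` to `op (of a)`. -/
def freeGroupRev {α : Type*} (x : FreeGroup α) : FreeGroup α :=
  (FreeGroup.lift (fun a => MulOpposite.op (FreeGroup.of a)) x).unop

namespace FreeGroup

variable {α : Type*}

/-- The exponent of a letter, as an integer. -/
def letterSign (x : α × Bool) : ℤ := if x.2 then 1 else -1

theorem letterSign_eq_one_or (x : α × Bool) : letterSign x = 1 ∨ letterSign x = -1 := by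
  unfold letterSign
  split <;> simp

theorem letterSign_not (a : α) (b : Bool) : letterSign (a, !b) = -letterSign (a, b) := by
  cases b <;> simp [letterSign]

theorem IsReduced.exists_cancellation {A B : List (α × Bool)} (hA : IsReduced A)
    (hB : IsReduced B) :
    ∃ u w v, A = u ++ w ∧ B = invRev w ++ v ∧ IsReduced (u ++ v) := by
  induction A using List.reverseRecOn generalizing B with
  | nil => exact ⟨[], [], B, rfl, rfl, hB⟩
  | append_singleton A p ih =>
    cases B with
    | nil => exact ⟨A ++ [p], [], [], by simp, rfl, by simpa using hA⟩
    | cons q B =>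
      by_cases hpq : p.1 = q.1 → p.2 = q.2
      · refine ⟨A ++ [p], [], q :: B, by simp, rfl, ?_⟩
        exact List.isChain_append.2 ⟨hA, hB, by simpa using hpq⟩
      · have hq : q = (p.1, !p.2) := by
          obtain ⟨a, b⟩ := p
          obtain ⟨c, d⟩ := q
          cases b <;> cases d <;> simp_all
        obtain ⟨u, w, v, rfl, rfl, h⟩ :=
          ih (List.isChain_append.1 hA).1 (List.isChain_cons.1 hB).2
        exact ⟨u, w ++ [p], v, by simp, by simp [invRev, hq], h⟩

theorem freeGroupRev_mk (L : List (α × Bool)) : freeGroupRev (mk L) = mk L.reverse := by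
  induction L with
  | nil => rfl
  | cons x L ih =>
    have h : (mk (x :: L) : FreeGroup α) = mk [x] * mk L := by simp [mul_mk]
    have hx : freeGroupRev (mk [x]) = mk [x] := by
      obtain ⟨a, b⟩ := x
      cases b <;> simp [freeGroupRev, of, inv_mk, invRev]
    rw [h, List.reverse_cons, ← mul_mk, ← ih]
    conv_rhs => rw [← hx]
    simp only [freeGroupRev, _root_.map_mul, MulOpposite.unop_mul]

variable [LinearOrder α]

/-- The sign of the turn between two consecutive letters of a word, at the corresponding vertex
of the Cayley tree: it is the sign of the letter with the larger generator, and it vanishes when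
the letters cancel. -/
def turnSign (x y : α × Bool) : ℤ :=
  if x.1 < y.1 then letterSign y
  else if y.1 < x.1 then letterSign x
  else if x.2 = y.2 then letterSign x else 0

theorem turnSign_comm (x y : α × Bool) : turnSign x y = turnSign y x := by
  obtain ⟨a, b⟩ := x
  obtain ⟨c, d⟩ := y
  rcases lt_trichotomy a c with h | rfl | h
  · simp [turnSign, h, h.not_gt]
  · cases b <;> cases d <;> simp [turnSign]
  · simp [turnSign, h, h.not_gt]

theorem turnSign_not (x y : α × Bool) :
    turnSign (x.1, !x.2) (y.1, !y.2) = -turnSign x y := by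
  obtain ⟨a, b⟩ := x
  obtain ⟨c, d⟩ := y
  simp only [turnSign, letterSign_not]
  split_ifs <;> simp_all

theorem turnSign_eq_one_or {x y : α × Bool} (h : x.1 = y.1 → x.2 = y.2) :
    turnSign x y = 1 ∨ turnSign x y = -1 := by
  have hx := letterSign_eq_one_or x
  have hy := letterSign_eq_one_or y
  unfold turnSign
  split_ifs with h₁ h₂ h₃
  · exact hy
  · exact hx
  · exact hx
  · exact absurd (h (le_antisymm (not_lt.1 h₂) (not_lt.1 h₁))) h₃

/-- At a vertex of the Cayley tree with three pairwise distinct directions, the turn signs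
satisfy the cocycle identity of a linear order up to one. -/
theorem turnSign_triple_le {p q r : α × Bool} (hpq : p.1 = q.1 → p.2 = q.2)
    (hqr : q.1 = r.1 → (!q.2) = r.2) (hpr : p.1 = r.1 → p.2 = r.2) :
    turnSign p q + turnSign (q.1, !q.2) r - turnSign p r ≤ 1 := by
  obtain ⟨a, b⟩ := p
  obtain ⟨c, d⟩ := q
  obtain ⟨e, f⟩ := r
  simp only at hpq hqr hpr
  rcases lt_trichotomy a c with h₁ | h₁ | h₁ <;> rcases lt_trichotomy c e with h₂ | h₂ | h₂ <;>
    rcases lt_trichotomy a e with h₃ | h₃ | h₃ <;>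
    first
    | order
    | cases b <;> cases d <;> cases f <;> simp_all [turnSign, letterSign, not_lt_of_gt]

/-- The turn sign at the place where two words are concatenated. -/
def junctionSign (u v : List (α × Bool)) : ℤ :=
  u.getLast?.elim 0 fun p => v.head?.elim 0 (turnSign p)

@[simp]
theorem junctionSign_nil_left (v : List (α × Bool)) : junctionSign [] v = 0 := rfl

@[simp]
theorem junctionSign_nil_right (u : List (α × Bool)) : junctionSign u [] = 0 := by
  cases h : u.getLast? <;> simp [junctionSign, h]

@[simp]
theorem junctionSign_concat_cons (u v : List (α × Bool)) (p q : α × Bool) :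
    junctionSign (u ++ [p]) (q :: v) = turnSign p q := by
  simp [junctionSign]

@[simp]
theorem junctionSign_singleton_cons (v : List (α × Bool)) (p q : α × Bool) :
    junctionSign [p] (q :: v) = turnSign p q := rfl

@[simp]
theorem junctionSign_cons_cons_left (u v : List (α × Bool)) (p q : α × Bool) :
    junctionSign (p :: q :: u) v = junctionSign (q :: u) v := by
  simp [junctionSign]

theorem junctionSign_le_one {u v : List (α × Bool)} (h : IsReduced (u ++ v)) :
    junctionSign u v ≤ 1 ∧ -1 ≤ junctionSign u v := by
  rcases u.eq_nil_or_concat with rfl | ⟨u, p, rfl⟩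
  · simp
  cases v with
  | nil => simp
  | cons q v =>
    have hpq : p.1 = q.1 → p.2 = q.2 := by
      have := (List.isChain_append.1 h).2.2
      simpa using this
    rcases turnSign_eq_one_or hpq with h | h <;> simp [h]

/-- The sum of all letter signs and all turn signs of a word. -/
def signature : List (α × Bool) → ℤ
  | [] => 0
  | x :: l => letterSign x + junctionSign [x] l + signature l

@[simp]
theorem signature_nil : signature ([] : List (α × Bool)) = 0 := rfl

theorem signature_append (u v : List (α × Bool)) :
    signature (u ++ v) = signature u + junctionSign u v + signature v := by
  induction u with
  | nil => simp
  | cons x u ih =>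
    cases u with
    | nil => simp [signature]
    | cons y u =>
      rw [List.cons_append, signature, ih, signature.eq_2 x]
      simp only [List.cons_append, junctionSign_singleton_cons, junctionSign_cons_cons_left]
      ring

theorem junctionSign_reverse (u v : List (α × Bool)) :
    junctionSign v.reverse u.reverse = junctionSign u v := by
  rcases u.eq_nil_or_concat with rfl | ⟨u, p, rfl⟩
  · simp
  cases v with
  | nil => simp
  | cons q v => simp [turnSign_comm]

theorem signature_reverse (u : List (α × Bool)) : signature u.reverse = signature u := by
  induction u with
  | nil => rfl
  | cons x u ih =>
    rw [List.reverse_cons, signature_append, ih, signature, ← junctionSign_reverse]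
    simp [signature]
    ring

theorem signature_map_not (u : List (α × Bool)) :
    signature (u.map fun x => (x.1, !x.2)) = -signature u := by
  induction u with
  | nil => rfl
  | cons x u ih =>
    rw [List.map_cons, signature, ih, signature, letterSign_not]
    cases u with
    | nil => simp
    | cons y u =>
      simp [turnSign_not]
      ring

theorem signature_invRev (u : List (α × Bool)) : signature (invRev u) = -signature u := by
  rw [invRev, signature_reverse, signature_map_not]

theorem IsReduced.odd_signature {u : List (α × Bool)} (h : IsReduced u) (hu : u ≠ []) :
    Odd (signature u) := by
  induction u with
  | nil => exact absurd rfl hu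
  | cons x u ih =>
    have hx : Odd (letterSign x) := by
      rcases letterSign_eq_one_or x with h | h <;> simp [h]
    cases u with
    | nil => simpa [signature] using hx
    | cons y u =>
      rw [isReduced_cons_cons] at h
      have hxy : Odd (turnSign x y) := by
        rcases turnSign_eq_one_or h.1 with h | h <;> simp [h]
      rw [signature]
      exact (hx.add_odd hxy).add_odd (ih h.2 (by simp))

theorem signature_append_invRev_append_le {u w v : List (α × Bool)} (huw : IsReduced (u ++ w))
    (hwv : IsReduced (invRev w ++ v)) (huv : IsReduced (u ++ v)) :
    signature (u ++ w) + signature (invRev w ++ v) ≤ signature (u ++ v) + 1 := by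
  have key : junctionSign u w + junctionSign (invRev w) v - junctionSign u v ≤ 1 := by
    have h₁ := junctionSign_le_one huw
    have h₂ := junctionSign_le_one hwv
    have h₃ := junctionSign_le_one huv
    rcases u.eq_nil_or_concat with rfl | ⟨u, p, rfl⟩
    · simpa using h₂.1
    cases w with
    | nil => simpa using neg_le.1 h₃.2
    | cons q w =>
      cases v with
      | nil => simpa using h₁.1
      | cons r v =>
        have e : invRev (q :: w) = invRev w ++ [(q.1, !q.2)] := by simp [invRev]
        rw [e] at hwv ⊢
        rw [List.concat_eq_append] at *
        simp only [junctionSign_concat_cons]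
        refine turnSign_triple_le ?_ ?_ ?_
        · simpa using (List.isChain_append.1 huw).2.2
        · simpa using (List.isChain_append.1 hwv).2.2
        · simpa using (List.isChain_append.1 huv).2.2
  rw [signature_append, signature_append, signature_append, signature_invRev]
  linarith

theorem signature_toWord_add_le (x y : FreeGroup α) :
    signature x.toWord + signature y.toWord ≤ signature (x * y).toWord + 1 := by
  obtain ⟨u, w, v, hx, hy, huv⟩ :=
    IsReduced.exists_cancellation (isReduced_toWord (x := x)) (isReduced_toWord (x := y))
  have hxy : (x * y).toWord = u ++ v := by
    have : x * y = mk (u ++ v) := by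
      rw [← mk_toWord (x := x), ← mk_toWord (x := y), hx, hy, ← mul_mk, ← mul_mk, ← mul_mk,
        ← inv_mk]
      group
    rw [this, toWord_mk, huv.reduce_eq]
  rw [hxy, hx, hy]
  exact signature_append_invRev_append_le (hx ▸ isReduced_toWord) (hy ▸ isReduced_toWord) huv

theorem signature_toWord_inv (x : FreeGroup α) :
    signature x⁻¹.toWord = -signature x.toWord := by
  rw [toWord_inv, signature_invRev]

theorem signature_toWord_ne_zero {x : FreeGroup α} (hx : x ≠ 1) : signature x.toWord ≠ 0 := by
  intro h
  have := (isReduced_toWord (x := x)).odd_signature (by simpa using hx)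
  simp [h] at this

theorem toWord_freeGroupRev (x : FreeGroup α) :
    (freeGroupRev x).toWord = x.toWord.reverse := by
  have h : IsReduced x.toWord.reverse := by
    rw [IsReduced, List.isChain_reverse]
    exact List.IsChain.imp (fun _ _ h e => (h e.symm).symm) (isReduced_toWord (x := x))
  conv_lhs => rw [← mk_toWord (x := x), freeGroupRev_mk, toWord_mk, h.reduce_eq]

theorem isStrictTotalOrder_signature :
    IsStrictTotalOrder (FreeGroup α) fun x y => 0 < signature (x⁻¹ * y).toWord where
  trichotomous x y hxy hyx := by
    by_contra hne
    have h := signature_toWord_ne_zero (x := x⁻¹ * y) (by rwa [Ne, inv_mul_eq_one])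
    rw [show y⁻¹ * x = (x⁻¹ * y)⁻¹ by group, signature_toWord_inv] at hyx
    omega
  irrefl x := by simp
  trans x y z hxy hyz := by
    have h := signature_toWord_add_le (x⁻¹ * y) (y⁻¹ * z)
    rw [show x⁻¹ * y * (y⁻¹ * z) = x⁻¹ * z by group] at h
    omega

end FreeGroup

/-- For every type `α`, the free group on `α` admits a left-invariant
linear order `<` such that `x > 1` iff `rev x > 1`, where `rev` is the word-reversal
anti-automorphism fixing each generator. -/
theorem freeGroup_exists_leftInvariant_order_compatible_with_rev (α : Type*) :
    ∃ lo : LinearOrder (FreeGroup α),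
      (∀ a x y : FreeGroup α, lo.lt x y → lo.lt (a * x) (a * y)) ∧
      (∀ x : FreeGroup α, lo.lt 1 x ↔ lo.lt 1 (freeGroupRev x)) := by
  classical
  let _ : LinearOrder α := linearOrderOfSTO WellOrderingRel
  have := FreeGroup.isStrictTotalOrder_signature (α := α)
  refine ⟨linearOrderOfSTO fun x y : FreeGroup α =>
    0 < FreeGroup.signature (x⁻¹ * y).toWord, fun a x y h => ?_, fun x => ?_⟩
  · change 0 < FreeGroup.signature ((a * x)⁻¹ * (a * y)).toWord
    rwa [show (a * x)⁻¹ * (a * y) = x⁻¹ * y by group]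
  · change 0 < FreeGroup.signature (1⁻¹ * x).toWord ↔
      0 < FreeGroup.signature (1⁻¹ * freeGroupRev x).toWord
    simp only [inv_one, one_mul, FreeGroup.toWord_freeGroupRev, FreeGroup.signature_reverse]
end

section
/- Let n ≥ 2 and let x ∈ B n satisfy rev(Δ n⁻¹ * x * Δ n) = x and π x = π (Δ n) in the symmetric group on n letters. Then there exists δ ∈ B n such that x = Δ n * δ * rev δ. -/
/-- The braid relators on `n` strands: `σᵢσⱼσᵢ = σⱼσᵢσⱼ` when `|i−j| = 1` and
`σᵢσⱼ = σⱼσᵢ` when `|i−j| ≥ 2`. -/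
def braidRels (n : ℕ) : Set (FreeGroup (Fin (n - 1))) :=
  { r | ∃ i j : Fin (n - 1),
      ((i : ℕ) + 1 = (j : ℕ) ∧
        r = (FreeGroup.of i * FreeGroup.of j * FreeGroup.of i) *
            (FreeGroup.of j * FreeGroup.of i * FreeGroup.of j)⁻¹) ∨
      ((i : ℕ) + 2 ≤ (j : ℕ) ∧
        r = (FreeGroup.of i * FreeGroup.of j) * (FreeGroup.of j * FreeGroup.of i)⁻¹) }

/-- The braid group on `n` strands, as a presented group on `n - 1` generators. -/
def BraidGroup (n : ℕ) : Type := PresentedGroup (braidRels n)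

instance (n : ℕ) : Group (BraidGroup n) := QuotientGroup.Quotient.group _

/-- The Artin generator `σ i` of the braid group (here `i : Fin (n-1)` corresponds to the
classical generator `σ_{i+1}`). -/
def braidGen {n : ℕ} (i : Fin (n - 1)) : BraidGroup n := PresentedGroup.of i

/-- `braidGen' n k` is `σ_{k+1}` for `k < n - 1` and `1` otherwise. -/
def braidGen' (n : ℕ) (k : ℕ) : BraidGroup n :=
  if h : k < n - 1 then braidGen ⟨k, h⟩ else 1

/-- `braidAsc n m = σ₁ σ₂ ⋯ σ_m`. -/
def braidAsc (n m : ℕ) : BraidGroup n := ((List.range m).map (braidGen' n)).prod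

/-- The Garside element `Δ n = (σ₁ ⋯ σ_{n-1}) (σ₁ ⋯ σ_{n-2}) ⋯ (σ₁ σ₂) (σ₁)`,
the closed form of the recursion `Δ 2 = σ₁`, `Δ n = σ₁ σ₂ ⋯ σ_{n-1} * Δ (n-1)`. -/
def garside (n : ℕ) : BraidGroup n :=
  ((List.range (n - 1)).map (fun j => braidAsc n (n - 1 - j))).prod

/-- The defining relations of the positive braid monoid on the generators `0, …, m - 1`. -/
inductive BraidMonoidRel (m : ℕ) : FreeMonoid (Fin m) → FreeMonoid (Fin m) → Prop
  | braid (i j : Fin m) (h : (i : ℕ) + 1 = j) :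
      BraidMonoidRel m (.of i * .of j * .of i) (.of j * .of i * .of j)
  | comm (i j : Fin m) (h : (i : ℕ) + 2 ≤ j) :
      BraidMonoidRel m (.of i * .of j) (.of j * .of i)

/-- The positive braid monoid on `m` generators, i.e. on `m + 1` strands. -/
abbrev BraidMonoid (m : ℕ) : Type := PresentedMonoid (BraidMonoidRel m)

namespace BraidMonoid

variable {m : ℕ}

/-- The Artin generators of the positive braid monoid. -/
def gen (i : Fin m) : BraidMonoid m := PresentedMonoid.of _ i

/-- Two generators are adjacent when they satisfy the braid relation of length three. -/
def Adj (i j : Fin m) : Prop := (i : ℕ) + 1 = j ∨ (j : ℕ) + 1 = i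

instance (i j : Fin m) : Decidable (Adj i j) := inferInstanceAs (Decidable (_ ∨ _))

theorem Adj.symm {i j : Fin m} (h : Adj i j) : Adj j i := Or.symm h

theorem Adj.ne {i j : Fin m} (h : Adj i j) : i ≠ j := by
  rintro rfl
  rcases h with h | h <;> omega

theorem gen_braid {i j : Fin m} (h : Adj i j) :
    gen i * gen j * gen i = gen j * gen i * gen j := by
  rcases h with h | h
  · exact PresentedMonoid.mk_eq_mk_of_rel (.braid i j h)
  · exact (PresentedMonoid.mk_eq_mk_of_rel (.braid j i h)).symm

theorem gen_comm {i j : Fin m} (h : ¬ Adj i j) : gen i * gen j = gen j * gen i := by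
  unfold Adj at h
  rcases lt_trichotomy (i : ℕ) j with h' | h' | h'
  · exact PresentedMonoid.mk_eq_mk_of_rel (.comm i j (by omega))
  · rw [Fin.ext h']
  · exact (PresentedMonoid.mk_eq_mk_of_rel (.comm j i (by omega))).symm

theorem gen_braid_mul {i j : Fin m} (h : Adj i j) (x : BraidMonoid m) :
    gen i * (gen j * (gen i * x)) = gen j * (gen i * (gen j * x)) := by
  simpa only [mul_assoc] using congrArg (· * x) (gen_braid h)

theorem gen_comm_mul {i j : Fin m} (h : ¬ Adj i j) (x : BraidMonoid m) :
    gen i * (gen j * x) = gen j * (gen i * x) := by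
  simpa only [mul_assoc] using congrArg (· * x) (gen_comm h)

theorem induction {P : BraidMonoid m → Prop} (one : P 1)
    (gen_mul : ∀ i x, P x → P (gen i * x)) (x : BraidMonoid m) : P x := by
  obtain ⟨w, rfl⟩ := PresentedMonoid.surjective_mk x
  induction w using FreeMonoid.inductionOn' with
  | one => simpa using one
  | of_mul i w ih => rw [map_mul]; exact gen_mul i _ ih

/-- The word length homomorphism. -/
def lengthHom (m : ℕ) : BraidMonoid m →* Multiplicative ℕ :=
  PresentedMonoid.lift (fun _ => Multiplicative.ofAdd 1) (by
    rintro _ _ (⟨i, j, h⟩ | ⟨i, j, h⟩) <;> simp)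

/-- The word length of a positive braid. -/
def len (x : BraidMonoid m) : ℕ := (lengthHom m x).toAdd

@[simp] theorem len_one : len (1 : BraidMonoid m) = 0 := by simp [len]

@[simp] theorem len_mul (x y : BraidMonoid m) : len (x * y) = len x + len y := by simp [len]

@[simp] theorem len_gen (i : Fin m) : len (gen i) = 1 := by
  simp [len, gen, lengthHom]

theorem eq_one_or_exists_gen_mul (x : BraidMonoid m) : x = 1 ∨ ∃ i y, x = gen i * y := by
  induction x using induction with
  | one => exact .inl rfl
  | gen_mul i x _ => exact .inr ⟨i, x, rfl⟩

theorem len_eq_zero {x : BraidMonoid m} : len x = 0 ↔ x = 1 := by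
  refine ⟨fun h => ?_, fun h => by simp [h]⟩
  rcases eq_one_or_exists_gen_mul x with hx | ⟨i, y, rfl⟩
  · exact hx
  · simp at h

/-- The word completing `gen i` to the least common right multiple of `gen i` and `gen j`. -/
def compl (i j : Fin m) : BraidMonoid m :=
  if i = j then 1 else if Adj i j then gen j * gen i else gen j

@[simp] theorem compl_self (i : Fin m) : compl i i = 1 := by simp [compl]

theorem compl_of_adj {i j : Fin m} (h : Adj i j) : compl i j = gen j * gen i := by
  simp [compl, h, h.ne]

theorem compl_of_not_adj {i j : Fin m} (hij : i ≠ j) (h : ¬ Adj i j) : compl i j = gen j := by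
  simp [compl, h, hij]

theorem gen_mul_compl (i j : Fin m) : gen i * compl i j = gen j * compl j i := by
  by_cases hij : i = j
  · subst hij; rfl
  by_cases h : Adj i j
  · rw [compl_of_adj h, compl_of_adj h.symm, ← mul_assoc, ← mul_assoc, gen_braid h]
  · rw [compl_of_not_adj hij h, compl_of_not_adj (Ne.symm hij) (fun h' => h h'.symm), gen_comm h]

/-- `gen i * x` and `gen j * y` agree because of the common multiple `gen i * compl i j`. -/
def Confluent (i : Fin m) (x : BraidMonoid m) (j : Fin m) (y : BraidMonoid m) : Prop :=
  ∃ z, x = compl i j * z ∧ y = compl j i * z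

theorem Confluent.symm {i j : Fin m} {x y : BraidMonoid m} (h : Confluent i x j y) :
    Confluent j y i x := by
  obtain ⟨z, hx, hy⟩ := h
  exact ⟨z, hy, hx⟩

/-- Garside's property for words of length at most `n + 1`. -/
def ConfluentUpTo (m n : ℕ) : Prop :=
  ∀ (i j : Fin m) (x y : BraidMonoid m), len x < n → gen i * x = gen j * y → Confluent i x j y

theorem ConfluentUpTo.cancel {n : ℕ} (H : ConfluentUpTo m n) {i : Fin m} {x y : BraidMonoid m}
    (hx : len x < n) (h : gen i * x = gen i * y) : x = y := by
  obtain ⟨z, rfl, rfl⟩ := H i i x y hx h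
  rfl

theorem ConfluentUpTo.far {n : ℕ} (H : ConfluentUpTo m n) {i j : Fin m} {x y : BraidMonoid m}
    (hx : len x < n) (hij : i ≠ j) (hadj : ¬ Adj i j) (h : gen i * x = gen j * y) :
    ∃ z, x = gen j * z ∧ y = gen i * z := by
  obtain ⟨z, rfl, rfl⟩ := H i j x y hx h
  exact ⟨z, by rw [compl_of_not_adj hij hadj],
    by rw [compl_of_not_adj hij.symm (fun h' => hadj h'.symm)]⟩

theorem ConfluentUpTo.adj {n : ℕ} (H : ConfluentUpTo m n) {i j : Fin m} {x y : BraidMonoid m}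
    (hx : len x < n) (hadj : Adj i j) (h : gen i * x = gen j * y) :
    ∃ z, x = gen j * (gen i * z) ∧ y = gen i * (gen j * z) := by
  obtain ⟨z, rfl, rfl⟩ := H i j x y hx h
  exact ⟨z, by rw [compl_of_adj hadj, mul_assoc], by rw [compl_of_adj hadj.symm, mul_assoc]⟩

theorem Confluent.trans_of_adj_of_not_adj {i j k : Fin m} {x y w : BraidMonoid m}
    (H : ConfluentUpTo m (len y)) (hik : i ≠ k) (hkj : k ≠ j) (hji : Adj j i) (hjk : ¬ Adj j k)
    (h₁ : Confluent i x j y) (h₂ : Confluent j y k w) : Confluent i x k w := by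
  obtain ⟨z, rfl, rfl⟩ := h₁
  obtain ⟨v, hv, rfl⟩ := h₂
  have hkj' : ¬ Adj k j := fun h => hjk h.symm
  rw [compl_of_adj hji, compl_of_not_adj hkj.symm hjk, mul_assoc] at hv
  rw [compl_of_adj hji] at H
  rw [compl_of_adj hji.symm, compl_of_not_adj hkj hkj', mul_assoc]
  by_cases hadj : Adj i k
  · obtain ⟨a, ha, rfl⟩ := H.adj (by simp) hadj hv
    obtain ⟨b, rfl, hb⟩ := H.far (by simp) hkj.symm hjk ha
    obtain ⟨c, rfl, rfl⟩ := H.adj (by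
      have := congrArg len ha; simp at this ⊢; omega) hji.symm hb
    refine ⟨gen j * (gen i * (gen k * c)), ?_, ?_⟩
    · rw [compl_of_adj hadj, mul_assoc, gen_braid_mul hadj (gen j * c), gen_comm_mul hjk,
        gen_comm_mul hkj' c, gen_braid_mul hji (gen k * c)]
    · rw [compl_of_adj hadj.symm, mul_assoc, gen_comm_mul hkj' (gen i * c),
        gen_braid_mul hji (gen k * (gen i * c)), gen_braid_mul hadj c, gen_comm_mul hjk]
  · obtain ⟨a, ha, rfl⟩ := H.far (by simp) hik hadj hv
    obtain ⟨b, rfl, rfl⟩ := H.far (by simp) hkj.symm hjk ha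
    refine ⟨gen j * (gen i * b), ?_, ?_⟩
    · rw [compl_of_not_adj hik hadj, gen_comm_mul hadj, gen_comm_mul hjk]
    · rw [compl_of_not_adj hik.symm (fun h => hadj h.symm), gen_braid_mul hji]

theorem Confluent.trans_of_adj_of_adj {i j k : Fin m} {x y w : BraidMonoid m}
    (H : ConfluentUpTo m (len y)) (hik : i ≠ k) (hji : Adj j i) (hjk : Adj j k)
    (h₁ : Confluent i x j y) (h₂ : Confluent j y k w) : Confluent i x k w := by
  obtain ⟨z, rfl, rfl⟩ := h₁
  obtain ⟨v, hv, rfl⟩ := h₂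
  have hadj : ¬ Adj i k := by
    unfold Adj at *
    omega
  have hadj' : ¬ Adj k i := fun h => hadj h.symm
  rw [compl_of_adj hji, compl_of_adj hjk, mul_assoc, mul_assoc] at hv
  rw [compl_of_adj hji] at H
  rw [compl_of_adj hji.symm, compl_of_adj hjk.symm, mul_assoc, mul_assoc]
  have hlen := congrArg len hv
  obtain ⟨a, ha, hb⟩ := H.far (by simp) hik hadj hv
  obtain ⟨b, rfl, rfl⟩ := H.adj (by simp) hjk ha
  obtain ⟨c, rfl, hc⟩ := H.adj (by simp at hlen ⊢; omega) hji hb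
  have hc' := H.cancel (by simp at hlen ⊢; omega) hc
  obtain ⟨d, rfl, rfl⟩ := H.far (by simp at hlen ⊢; omega) hik.symm hadj' hc'
  refine ⟨gen j * (gen k * (gen i * (gen j * d))), ?_, ?_⟩
  · rw [compl_of_not_adj hik hadj, gen_comm_mul hadj (gen j * (gen i * d)),
      gen_braid_mul hji.symm d, gen_braid_mul hjk]
  · rw [compl_of_not_adj hik.symm hadj', gen_comm_mul hadj' (gen j * (gen k * d)),
      gen_braid_mul hjk.symm d, gen_braid_mul hji, gen_comm_mul hadj (gen j * d)]

theorem Confluent.trans {i j k : Fin m} {x y w : BraidMonoid m}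
    (H : ConfluentUpTo m (len y)) (h₁ : Confluent i x j y) (h₂ : Confluent j y k w) :
    Confluent i x k w := by
  by_cases hij : i = j
  · subst hij
    obtain ⟨z, rfl, rfl⟩ := h₁
    exact h₂
  by_cases hjk : j = k
  · subst hjk
    obtain ⟨z, rfl, rfl⟩ := h₂
    exact h₁
  by_cases hik : i = k
  · subst hik
    obtain ⟨z, rfl, rfl⟩ := h₁
    obtain ⟨v, hv, rfl⟩ := h₂
    suffices z = v by subst this; exact ⟨compl i j * z, by simp, by simp⟩
    by_cases hadj : Adj j i
    · rw [compl_of_adj hadj, mul_assoc, mul_assoc] at hv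
      rw [compl_of_adj hadj] at H
      exact H.cancel (by simp) (H.cancel (by simp) hv)
    · rw [compl_of_not_adj hjk hadj] at hv H
      exact H.cancel (by simp) hv
  by_cases hji' : Adj j i
  · by_cases hjk' : Adj j k
    · exact trans_of_adj_of_adj H hik hji' hjk' h₁ h₂
    · exact trans_of_adj_of_not_adj H hik (Ne.symm hjk) hji' hjk' h₁ h₂
  · by_cases hjk' : Adj j k
    · refine (trans_of_adj_of_not_adj H (Ne.symm hik) hij hjk' hji' h₂.symm h₁.symm).symm
    · obtain ⟨z, rfl, rfl⟩ := h₁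
      obtain ⟨v, hv, rfl⟩ := h₂
      have hij' : ¬ Adj i j := fun h => hji' h.symm
      have hkj' : ¬ Adj k j := fun h => hjk' h.symm
      rw [compl_of_not_adj (Ne.symm hij) hji', compl_of_not_adj hjk hjk'] at hv
      rw [compl_of_not_adj (Ne.symm hij) hji'] at H
      rw [compl_of_not_adj hij hij', compl_of_not_adj (Ne.symm hjk) hkj']
      obtain ⟨u, rfl, rfl⟩ := H i k z v (by simp) hv
      refine ⟨gen j * u, ?_, ?_⟩
      · by_cases hadj : Adj i k
        · rw [compl_of_adj hadj, mul_assoc, mul_assoc, gen_comm_mul hjk', gen_comm_mul hji']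
        · rw [compl_of_not_adj hik hadj, gen_comm_mul hjk']
      · by_cases hadj : Adj k i
        · rw [compl_of_adj hadj, mul_assoc, mul_assoc, gen_comm_mul hji', gen_comm_mul hjk']
        · rw [compl_of_not_adj (Ne.symm hik) hadj, gen_comm_mul hji']

theorem confluentUpTo (m n : ℕ) : ConfluentUpTo m n := by
  induction n with
  | zero => intro i j x y h; omega
  | succ n ih =>
    have key : ∀ u v : FreeMonoid (Fin m), ConGen.Rel (BraidMonoidRel m) u v →
        len (PresentedMonoid.mk (BraidMonoidRel m) u) ≤ n + 1 →
        (u = 1 ∧ v = 1) ∨ ∃ i u' j v', u = .of i * u' ∧ v = .of j * v' ∧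
          Confluent i (PresentedMonoid.mk _ u') j (PresentedMonoid.mk _ v') := by
      intro u v h
      induction h with
      | of u v h =>
        intro _
        right
        rcases h with ⟨i, j, h⟩ | ⟨i, j, h⟩
        · exact ⟨i, .of j * .of i, j, .of i * .of j, mul_assoc _ _ _, mul_assoc _ _ _, 1,
            by rw [compl_of_adj (.inl h), mul_one]; rfl,
            by rw [compl_of_adj (.inr h), mul_one]; rfl⟩
        · have hij : i ≠ j := by rintro rfl; omega
          have hadj : ¬ Adj i j := by unfold Adj; omega
          exact ⟨i, .of j, j, .of i, rfl, rfl, 1,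
            by rw [compl_of_not_adj hij hadj, mul_one]; rfl,
            by rw [compl_of_not_adj hij.symm (fun h => hadj h.symm), mul_one]; rfl⟩
      | refl u =>
        intro _
        induction u using FreeMonoid.casesOn with
        | one => exact .inl ⟨rfl, rfl⟩
        | of_mul i u => exact .inr ⟨i, u, i, u, rfl, rfl, .mk _ u, by simp, by simp⟩
      | @symm u v h ih =>
        intro hlen
        rcases ih (by rwa [PresentedMonoid.mk_eq_mk_iff.2 h]) with
          ⟨hu, hv⟩ | ⟨i, u', j, v', hu, hv, hc⟩
        · exact .inl ⟨hv, hu⟩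
        · exact .inr ⟨j, v', i, u', hv, hu, hc.symm⟩
      | @trans u v w h₁ h₂ ih₁ ih₂ =>
        intro hlen
        have hlen' := hlen
        rw [PresentedMonoid.mk_eq_mk_iff.2 h₁] at hlen'
        rcases ih₁ hlen with ⟨rfl, rfl⟩ | ⟨i, u', j, v', rfl, rfl, hc₁⟩
        · exact ih₂ hlen
        rcases ih₂ hlen' with ⟨hv, -⟩ | ⟨j', v'', k, w', hv, rfl, hc₂⟩
        · simp at hv
        obtain ⟨rfl, rfl⟩ : j = j' ∧ v' = v'' := by
          have := congrArg FreeMonoid.toList hv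
          simpa using this
        refine .inr ⟨i, u', k, w', rfl, rfl, hc₁.trans ?_ hc₂⟩
        rw [map_mul, len_mul] at hlen'
        have : len (PresentedMonoid.mk (BraidMonoidRel m) (.of j)) = 1 := len_gen j
        exact fun a b x y hx => ih a b x y (by omega)
      | @mul u v w z h₁ h₂ ih₁ ih₂ =>
        intro hlen
        rw [map_mul, len_mul] at hlen
        rcases ih₁ (by omega) with ⟨rfl, rfl⟩ | ⟨i, u', j, v', rfl, rfl, a, ha, hb⟩
        · simpa using ih₂ (by omega)
        · refine .inr ⟨i, u' * w, j, v' * z, mul_assoc _ _ _, mul_assoc _ _ _,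
            a * PresentedMonoid.mk _ w, ?_, ?_⟩
          · rw [map_mul, ha, mul_assoc]
          · rw [map_mul, hb, mul_assoc, PresentedMonoid.mk_eq_mk_iff.2 h₂]
    intro i j x y hx h
    obtain ⟨u, rfl⟩ := PresentedMonoid.surjective_mk x
    obtain ⟨v, rfl⟩ := PresentedMonoid.surjective_mk y
    rcases key (.of i * u) (.of j * v)
      (PresentedMonoid.mk_eq_mk_iff.1 (by rw [map_mul, map_mul]; exact h))
      (by rw [map_mul, len_mul]; exact (add_le_add_left (len_gen i).le _).trans (by omega)) with
      ⟨hu, -⟩ | ⟨i', u', j', v', hu, hv, hc⟩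
    · simp at hu
    · have hu := congrArg FreeMonoid.toList hu
      have hv := congrArg FreeMonoid.toList hv
      simp at hu hv
      obtain ⟨rfl, rfl⟩ := hu
      obtain ⟨rfl, rfl⟩ := hv
      exact hc

theorem confluent_of_gen_mul_eq {i j : Fin m} {x y : BraidMonoid m}
    (h : gen i * x = gen j * y) : Confluent i x j y :=
  confluentUpTo m _ i j x y (Nat.lt_succ_self _) h

instance : IsLeftCancelMul (BraidMonoid m) where
  mul_left_cancel x y z h := by
    induction x using induction with
    | one => simpa using h
    | gen_mul i x ih =>
      refine ih ((confluentUpTo m (len (x * y) + 1)).cancel (Nat.lt_succ_self _) (i := i) ?_)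
      simpa only [mul_assoc] using h

/-- Word reversal, as a homomorphism to the opposite monoid. -/
def revHom (m : ℕ) : BraidMonoid m →* (BraidMonoid m)ᵐᵒᵖ :=
  PresentedMonoid.lift (fun i => MulOpposite.op (gen i)) (by
    rintro _ _ (⟨i, j, h⟩ | ⟨i, j, h⟩)
    · simp only [map_mul, FreeMonoid.lift_eval_of, ← MulOpposite.op_mul, ← mul_assoc]
      rw [gen_braid (.inl h)]
    · simp only [map_mul, FreeMonoid.lift_eval_of, ← MulOpposite.op_mul]
      rw [gen_comm]
      unfold Adj; omega)

/-- Word reversal on the positive braid monoid. -/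
def rev (x : BraidMonoid m) : BraidMonoid m := (revHom m x).unop

@[simp] theorem rev_one : rev (1 : BraidMonoid m) = 1 := by simp [rev]

@[simp] theorem rev_mul (x y : BraidMonoid m) : rev (x * y) = rev y * rev x := by simp [rev]

@[simp] theorem rev_gen (i : Fin m) : rev (gen i) = gen i := by
  simp [rev, revHom, gen]

@[simp] theorem rev_rev (x : BraidMonoid m) : rev (rev x) = x := by
  induction x using induction with
  | one => simp
  | gen_mul i x ih => simp [ih]

instance : IsRightCancelMul (BraidMonoid m) where
  mul_right_cancel x y z h := by
    have := congrArg rev h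
    simp only [rev_mul] at this
    simpa using congrArg rev (mul_left_cancel this)

theorem len_le_of_dvd {x y : BraidMonoid m} (h : x ∣ y) : len x ≤ len y := by
  obtain ⟨z, rfl⟩ := h
  simp

theorem dvd_of_mul_dvd_mul_left {x y z : BraidMonoid m} (h : x * y ∣ x * z) : y ∣ z := by
  obtain ⟨w, hw⟩ := h
  exact ⟨w, mul_left_cancel (by rw [hw, mul_assoc])⟩

theorem exists_eq_compl_mul {i j : Fin m} {x : BraidMonoid m} (h : gen j ∣ gen i * x) :
    compl i j ∣ x := by
  obtain ⟨y, hy⟩ := h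
  obtain ⟨z, hz, -⟩ := confluent_of_gen_mul_eq hy
  exact ⟨z, hz⟩

/-- Two left divisors `x`, `y` of both `p` and `q` have a common multiple dividing `p` and `q`. -/
theorem exists_common_multiple_dvd {p q x y : BraidMonoid m} (hxp : x ∣ p) (hxq : x ∣ q)
    (hyp : y ∣ p) (hyq : y ∣ q) : ∃ l, x ∣ l ∧ y ∣ l ∧ l ∣ p ∧ l ∣ q := by
  induction h : len p using Nat.strong_induction_on generalizing p q x y with
  | _ n ih =>
  subst h
  rcases eq_one_or_exists_gen_mul x with rfl | ⟨i, x', rfl⟩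
  · exact ⟨y, one_dvd _, dvd_rfl, hyp, hyq⟩
  rcases eq_one_or_exists_gen_mul y with rfl | ⟨j, y', rfl⟩
  · exact ⟨_, dvd_rfl, one_dvd _, hxp, hxq⟩
  obtain ⟨p₁, rfl⟩ := (dvd_mul_right _ _).trans hxp
  obtain ⟨q₁, rfl⟩ := (dvd_mul_right _ _).trans hxq
  obtain ⟨P, rfl⟩ := exists_eq_compl_mul ((dvd_mul_right _ _).trans hyp)
  obtain ⟨Q, rfl⟩ := exists_eq_compl_mul ((dvd_mul_right _ _).trans hyq)
  obtain ⟨a, hxa, hca, hap, haq⟩ := ih (len (compl i j * P)) (by simp)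
    (dvd_of_mul_dvd_mul_left hxp) (dvd_of_mul_dvd_mul_left hxq)
    (dvd_mul_right (compl i j) P) (dvd_mul_right _ Q) rfl
  have hcomm : ∀ R : BraidMonoid m, gen i * (compl i j * R) = gen j * (compl j i * R) := by
    intro R
    rw [← mul_assoc, gen_mul_compl, mul_assoc]
  have hlen := congrArg len (hcomm P)
  rw [hcomm] at hyp hyq
  obtain ⟨b, hyb, hcb, hbp, hbq⟩ := ih (len (compl j i * P)) (by simp at hlen ⊢; omega)
    (dvd_of_mul_dvd_mul_left hyp) (dvd_of_mul_dvd_mul_left hyq)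
    (dvd_mul_right (compl j i) P) (dvd_mul_right _ Q) rfl
  obtain ⟨a, rfl⟩ := hca
  obtain ⟨b, rfl⟩ := hcb
  obtain ⟨l, hal, hbl, hlp, hlq⟩ := ih (len P) (by simp; omega)
    (dvd_of_mul_dvd_mul_left hap) (dvd_of_mul_dvd_mul_left haq)
    (dvd_of_mul_dvd_mul_left hbp) (dvd_of_mul_dvd_mul_left hbq) rfl
  refine ⟨gen i * (compl i j * l), mul_dvd_mul_left _ (hxa.trans (mul_dvd_mul_left _ hal)), ?_,
    mul_dvd_mul_left _ (mul_dvd_mul_left _ hlp), mul_dvd_mul_left _ (mul_dvd_mul_left _ hlq)⟩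
  rw [hcomm]
  exact mul_dvd_mul_left _ (hyb.trans (mul_dvd_mul_left _ hbl))

/-- Any two elements have a common left divisor which is divisible by all common generators. -/
theorem exists_common_divisor (p q : BraidMonoid m) :
    ∃ a, a ∣ p ∧ a ∣ q ∧ ∀ i, gen i ∣ p → gen i ∣ q → gen i ∣ a := by
  classical
  let P : ℕ → Prop := fun k => ∃ a, a ∣ p ∧ a ∣ q ∧ len a = k
  have h0 : P 0 := ⟨1, one_dvd _, one_dvd _, len_one⟩
  obtain ⟨a, hap, haq, hlen⟩ := Nat.findGreatest_spec (P := P) (Nat.zero_le (len p)) h0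
  refine ⟨a, hap, haq, fun i hip hiq => ?_⟩
  obtain ⟨l, hal, hil, hlp, hlq⟩ := exists_common_multiple_dvd hap haq hip hiq
  have hle : len l ≤ len a := by
    rw [hlen]
    exact Nat.le_findGreatest (len_le_of_dvd hlp) ⟨l, hlp, hlq, rfl⟩
  obtain ⟨c, rfl⟩ := hal
  obtain rfl : c = 1 := len_eq_zero.1 (by simpa using hle)
  simpa using hil

/-- If every generator divides `D`, and no nontrivial left divisor of `D` satisfies the
multiplicative condition `f = 1`, then every palindrome satisfying `f = 1` is of the form
`d * rev d`. -/
theorem exists_eq_mul_rev {H : Type*} [Group H] (f : BraidMonoid m →* H)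
    (hf : ∀ i, f (gen i) * f (gen i) = 1) {D : BraidMonoid m} (hD : ∀ i, gen i ∣ D)
    (hD' : ∀ a, a ∣ D → f a = 1 → a = 1) {p : BraidMonoid m} (hp : rev p = p) (hfp : f p = 1) :
    ∃ d, p = d * rev d := by
  induction h : len p using Nat.strong_induction_on generalizing p with
  | _ n ih =>
  subst h
  obtain ⟨a, ⟨q, rfl⟩, haD, ha⟩ := exists_common_divisor p D
  rcases eq_one_or_exists_gen_mul (rev q) with hq | ⟨i, r, hr⟩
  · obtain rfl : q = 1 := by simpa using congrArg rev hq
    rw [mul_one] at hfp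
    exact ⟨1, by simp [hD' a haD hfp]⟩
  · have hi : gen i ∣ a * q := by
      rw [← hp, rev_mul, hr, mul_assoc]
      exact dvd_mul_right _ _
    obtain ⟨b, rfl⟩ := ha i hi (hD i)
    have hpe : gen i * b * q = gen i * (r * rev b) * gen i := by
      conv_lhs => rw [← hp]
      simp [hr, mul_assoc]
    rw [hpe] at hp hfp ih ⊢
    obtain ⟨d, hd⟩ := ih (len (r * rev b)) (by simp) (p := r * rev b) (by
      simp only [rev_mul, rev_gen, ← mul_assoc] at hp
      have := mul_right_cancel hp
      simp only [mul_assoc] at this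
      simpa using mul_left_cancel this) (by
      rw [map_mul, map_mul, mul_assoc] at hfp
      have h1 : f (gen i) = (f (gen i))⁻¹ := eq_inv_of_mul_eq_one_left (hf i)
      rw [← mul_assoc, mul_eq_one_iff_eq_inv, ← h1] at hfp
      simpa using hfp) rfl
    exact ⟨gen i * d, by simp [hd, mul_assoc]⟩

/-- The `k`-th generator, or `1` if `k` is out of range. -/
def gen' (m k : ℕ) : BraidMonoid m := if h : k < m then gen ⟨k, h⟩ else 1

/-- The product of the first `k` generators in ascending order. -/
def asc (m : ℕ) : ℕ → BraidMonoid m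
  | 0 => 1
  | k + 1 => asc m k * gen' m k

/-- The Garside element of the first `k` generators. -/
def delta (m : ℕ) : ℕ → BraidMonoid m
  | 0 => 1
  | k + 1 => asc m (k + 1) * delta m k

@[simp] theorem rev_gen' (k : ℕ) : rev (gen' m k) = gen' m k := by
  unfold gen'
  split <;> simp

theorem gen'_comm {i j : ℕ} (h : i + 2 ≤ j) : Commute (gen' m i) (gen' m j) := by
  unfold gen'
  split
  · split
    · refine gen_comm ?_
      unfold Adj
      simp
      omega
    · exact .one_right _
  · exact .one_left _

theorem gen'_braid {i : ℕ} (h : i + 1 < m) :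
    gen' m (i + 1) * gen' m i * gen' m (i + 1) = gen' m i * gen' m (i + 1) * gen' m i := by
  rw [gen', gen', dif_pos h, dif_pos (Nat.lt_of_succ_lt h)]
  exact gen_braid (.inr rfl)

theorem asc_comm {j k : ℕ} (h : k + 1 ≤ j) : Commute (asc m k) (gen' m j) := by
  induction k with
  | zero => exact .one_left _
  | succ k ih => exact (ih (by omega)).mul_left (gen'_comm h)

theorem delta_comm {j k : ℕ} (h : k + 1 ≤ j) : Commute (delta m k) (gen' m j) := by
  induction k with
  | zero => exact .one_left _
  | succ k ih => exact (asc_comm h).mul_left (ih (by omega))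

theorem delta_succ (k : ℕ) : delta m (k + 1) = delta m k * rev (asc m (k + 1)) := by
  induction k with
  | zero => simp [delta, asc]
  | succ k ih =>
    calc delta m (k + 2) = asc m (k + 1) * gen' m (k + 1) * (delta m k * rev (asc m (k + 1))) := by
          rw [← ih]; rfl
      _ = asc m (k + 1) * delta m k * (gen' m (k + 1) * rev (asc m (k + 1))) := by
          simp only [mul_assoc]
          rw [← mul_assoc (gen' m (k + 1)), ← (delta_comm le_rfl).eq, mul_assoc]
      _ = delta m (k + 1) * rev (asc m (k + 2)) := by
          rw [asc.eq_2 m (k + 1), rev_mul, rev_gen']; rfl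

@[simp] theorem rev_delta (k : ℕ) : rev (delta m k) = delta m k := by
  induction k with
  | zero => simp [delta]
  | succ k ih => rw [delta, rev_mul, ih, ← delta_succ, delta]

theorem gen'_mul_asc {j k : ℕ} (hjk : j + 1 < k) (hk : k ≤ m) :
    gen' m (j + 1) * asc m k = asc m k * gen' m j := by
  induction k with
  | zero => omega
  | succ k ih =>
    rcases Nat.lt_succ_iff_lt_or_eq.1 hjk with h | rfl
    · rw [asc, ← mul_assoc, ih h (by omega), mul_assoc, mul_assoc, (gen'_comm (by omega)).eq]
    · rw [asc, asc]
      calc gen' m (j + 1) * (asc m j * gen' m j * gen' m (j + 1))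
          = gen' m (j + 1) * asc m j * gen' m j * gen' m (j + 1) := by simp only [mul_assoc]
        _ = asc m j * (gen' m (j + 1) * gen' m j * gen' m (j + 1)) := by
            rw [← (asc_comm le_rfl).eq]; simp only [mul_assoc]
        _ = _ := by rw [gen'_braid (by omega)]; simp only [mul_assoc]

theorem gen'_mul_delta {i j k : ℕ} (h : i + j + 1 = k) (hk : k ≤ m) :
    gen' m i * delta m k = delta m k * gen' m j := by
  induction k generalizing i j with
  | zero => omega
  | succ k ih =>
    have succ_case : ∀ i j, i + 1 + j + 1 = k + 1 →
        gen' m (i + 1) * delta m (k + 1) = delta m (k + 1) * gen' m j := by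
      intro i j h
      rw [delta, ← mul_assoc, gen'_mul_asc (by omega) hk, mul_assoc, mul_assoc,
        ih (i := i) (j := j) (by omega) (by omega)]
    rcases i with _ | i
    · rcases j with _ | j
      · obtain rfl : k = 0 := by omega
        simp [delta, asc]
      · simpa using (congrArg rev (succ_case j 0 (by omega))).symm
    · exact succ_case i j h

theorem gen_mul_delta_self (i : Fin m) : gen i * delta m m = delta m m * gen i.rev := by
  have := gen'_mul_delta (m := m) (i := i) (j := i.rev) (k := m)
    (by rw [Fin.val_rev]; omega) le_rfl
  rwa [gen', gen', dif_pos i.isLt, dif_pos i.rev.isLt] at this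

theorem gen_dvd_asc {k : ℕ} (hm : 0 < m) : gen ⟨0, hm⟩ ∣ asc m (k + 1) := by
  induction k with
  | zero => simp [asc, gen', hm]
  | succ k ih => exact ih.trans (dvd_mul_right _ _)

theorem gen_dvd_delta_self (i : Fin m) : gen i ∣ delta m m := by
  have hm : 0 < m := i.pos
  suffices ∀ k, k ≤ m → ∀ i : Fin m, (i : ℕ) < k → gen i ∣ delta m k from
    this m le_rfl i i.isLt
  intro k
  induction k with
  | zero => intro _ i h; omega
  | succ k ih =>
    intro hk i hi
    rcases Nat.lt_succ_iff_lt_or_eq.1 hi with h | h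
    · rw [delta_succ]
      exact (ih (by omega) i h).trans (dvd_mul_right _ _)
    · obtain ⟨c, hc⟩ : gen ⟨0, hm⟩ ∣ delta m (k + 1) :=
        (gen_dvd_asc hm).trans (dvd_mul_right _ _)
      have hc' : delta m (k + 1) = rev c * gen ⟨0, hm⟩ := by
        rw [← rev_delta, hc]; simp
      have hcomm := gen'_mul_delta (m := m) (i := i) (j := 0) (k := k + 1) (by omega) hk
      simp only [gen', i.isLt, hm, dite_true, Fin.eta] at hcomm
      conv_lhs at hcomm => rw [hc', ← mul_assoc]
      exact ⟨rev c, (mul_right_cancel hcomm).symm⟩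

theorem delta_sq_comm (x : BraidMonoid m) : Commute (delta m m * delta m m) x := by
  induction x using induction with
  | one => exact .one_right _
  | gen_mul i x ih =>
    refine .mul_right ?_ ih
    rw [commute_iff_eq, ← mul_assoc (gen i), gen_mul_delta_self, mul_assoc, mul_assoc,
      gen_mul_delta_self, Fin.rev_rev]

theorem len_asc_le (k : ℕ) : len (asc m k) ≤ k := by
  induction k with
  | zero => simp [asc]
  | succ k ih =>
    have : len (gen' m k) ≤ 1 := by unfold gen'; split <;> simp
    rw [asc, len_mul]
    omega

theorem len_delta_le (k : ℕ) : len (delta m k) ≤ (k + 1).choose 2 := by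
  induction k with
  | zero => simp [delta]
  | succ k ih =>
    have := len_asc_le (m := m) (k + 1)
    rw [delta, len_mul, Nat.choose_succ_succ' (k + 1) 1, Nat.choose_one_right]
    exact add_le_add this ih

/-- The number of inversions of a permutation. -/
def inversions {N : ℕ} (w : Equiv.Perm (Fin N)) : ℕ :=
  (Finset.univ.filter fun p : Fin N × Fin N => p.1 < p.2 ∧ w p.2 < w p.1).card

theorem inversions_mul_swap_le (w : Equiv.Perm (Fin (m + 1))) (i : Fin m) :
    inversions (w * Equiv.swap i.castSucc i.succ) ≤ inversions w + 1 := by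
  classical
  set s := Equiv.swap i.castSucc i.succ with hs
  have hlt : ∀ a b : Fin (m + 1), a < b → (a, b) ≠ (i.castSucc, i.succ) → s a < s b := by
    intro a b hab hne
    rw [hs, Equiv.swap_apply_def, Equiv.swap_apply_def]
    simp only [ne_eq, Prod.mk.injEq, Fin.ext_iff, Fin.lt_def, Fin.val_castSucc,
      Fin.val_succ] at *
    split_ifs <;> simp <;> omega
  have hss : ∀ a, s (s a) = a := fun a => Equiv.swap_apply_self _ _ _
  unfold inversions
  have hsub : (Finset.univ.filter fun p : Fin (m + 1) × Fin (m + 1) =>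
      p.1 < p.2 ∧ (w * s) p.2 < (w * s) p.1) ⊆ insert (i.castSucc, i.succ)
    ((Finset.univ.filter fun p : Fin (m + 1) × Fin (m + 1) =>
      p.1 < p.2 ∧ w p.2 < w p.1).image (Prod.map s s)) := by
    rintro ⟨a, b⟩ hab
    replace hab := (Finset.mem_filter.1 hab).2
    rw [Finset.mem_insert]
    by_cases hne : (a, b) = (i.castSucc, i.succ)
    · exact .inl hne
    · exact .inr (Finset.mem_image.2 ⟨(s a, s b), by
        simpa using ⟨hlt a b hab.1 hne, hab.2⟩, by simp [hss]⟩)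
  refine (Finset.card_le_card hsub).trans ((Finset.card_insert_le _ _).trans ?_)
  exact Nat.succ_le_succ Finset.card_image_le

section Perm

variable {f : BraidMonoid m →* Equiv.Perm (Fin (m + 1))}
  (hf : ∀ i, f (gen i) = Equiv.swap i.castSucc i.succ)

include hf

theorem inversions_mul_le (w : Equiv.Perm (Fin (m + 1))) (x : BraidMonoid m) :
    inversions (w * f x) ≤ inversions w + len x := by
  induction x using induction generalizing w with
  | one => simp
  | gen_mul i x ih =>
    rw [map_mul, ← mul_assoc, hf, len_mul, len_gen]
    have := ih (w * Equiv.swap i.castSucc i.succ)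
    have := inversions_mul_swap_le w i
    omega

theorem perm_asc_apply {k : ℕ} (hk : k ≤ m) (a : Fin (m + 1)) :
    (f (asc m k) a : ℕ) =
      if (a : ℕ) < k then (a : ℕ) + 1 else if (a : ℕ) = k then 0 else (a : ℕ) := by
  induction k generalizing a with
  | zero => simp [asc]
  | succ k ih =>
    rw [asc, map_mul, Equiv.Perm.mul_apply, ih (by omega), gen', dif_pos (by omega), hf,
      Equiv.swap_apply_def]
    simp only [Fin.ext_iff, Fin.val_castSucc, Fin.val_succ]
    split_ifs <;> simp at * <;> omega

theorem perm_delta_apply {k : ℕ} (hk : k ≤ m) (a : Fin (m + 1)) :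
    (f (delta m k) a : ℕ) = if (a : ℕ) ≤ k then k - (a : ℕ) else (a : ℕ) := by
  induction k with
  | zero => simp [delta]
  | succ k ih =>
    rw [delta, map_mul, Equiv.Perm.mul_apply, perm_asc_apply hf hk, ih (by omega)]
    split_ifs <;> omega

theorem perm_delta_self : f (delta m m) = Fin.revPerm := by
  ext a
  rw [perm_delta_apply hf le_rfl, Fin.revPerm_apply, Fin.val_rev, if_pos (by omega)]
  omega

theorem eq_one_of_dvd_delta_of_perm_eq_one {a : BraidMonoid m} (ha : a ∣ delta m m)
    (hfa : f a = 1) : a = 1 := by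
  obtain ⟨b, hb⟩ := ha
  have h₁ := len_delta_le (m := m) m
  have h₂ : inversions (f b) ≤ len b := by
    have h0 : inversions (1 : Equiv.Perm (Fin (m + 1))) = 0 := by
      rw [inversions, Finset.card_eq_zero, Finset.filter_eq_empty_iff]
      exact fun p _ hp => hp.1.not_gt hp.2
    simpa [h0] using inversions_mul_le hf 1 b
  have h₃ : f b = Fin.revPerm := by
    rw [← perm_delta_self hf, hb, map_mul, hfa, one_mul]
  have h₄ : inversions (Fin.revPerm (n := m + 1)) = (m + 1).choose 2 := by
    simp [inversions, Fintype.card_product_filter_lt]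
  rw [hb, len_mul] at h₁
  rw [h₃, h₄] at h₂
  exact len_eq_zero.1 (by omega)

end Perm

end BraidMonoid

namespace BraidMonoid

theorem delta_sq_mem_center (m : ℕ) (z : Submonoid.powers (delta m m * delta m m))
    (x : BraidMonoid m) : Commute (z : BraidMonoid m) x := by
  obtain ⟨_, k, rfl⟩ := z
  exact (delta_sq_comm x).pow_left k

instance (m : ℕ) : OreLocalization.OreSet (Submonoid.powers (delta m m * delta m m)) where
  ore_right_cancel _ _ s h := ⟨s, congrArg (↑s * ·) (mul_right_cancel h)⟩
  oreNum r _ := r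
  oreDenom _ s := s
  ore_eq r s := delta_sq_mem_center m s r

/-- The localization of the positive braid monoid at the full twist. -/
abbrev Frac (m : ℕ) : Type :=
  OreLocalization (Submonoid.powers (delta m m * delta m m)) (BraidMonoid m)

/-- The map from the positive braid monoid to its localization at the full twist. -/
def toFrac (m : ℕ) : BraidMonoid m →* Frac m := OreLocalization.numeratorHom

theorem toFrac_injective (m : ℕ) : Function.Injective (toFrac m) := by
  intro x y h
  obtain ⟨u, v, h₁, h₂⟩ := OreLocalization.oreDiv_eq_iff.1 h
  simp only [Submonoid.smul_def, smul_eq_mul, OneMemClass.coe_one, mul_one] at h₁ h₂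
  subst h₂
  exact (mul_left_cancel h₁).symm

theorem isUnit_toFrac_gen {m : ℕ} (i : Fin m) : IsUnit (toFrac m (gen i)) := by
  have hz : IsUnit (toFrac m (delta m m * delta m m)) :=
    OreLocalization.numerator_isUnit ⟨_, Submonoid.mem_powers _⟩
  obtain ⟨c, hc⟩ := gen_dvd_delta_self i
  have hc' : delta m m = rev c * gen i := by
    rw [← rev_delta, hc]; simp
  refine isUnit_iff_exists_and_exists.2 ⟨⟨toFrac m (c * delta m m) * ↑hz.unit⁻¹, ?_⟩,
    ⟨↑hz.unit⁻¹ * toFrac m (delta m m * rev c), ?_⟩⟩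
  · rw [← mul_assoc, ← map_mul, ← mul_assoc, ← hc]
    exact hz.mul_val_inv
  · rw [mul_assoc, ← map_mul, mul_assoc, ← hc']
    exact hz.val_inv_mul

variable {n : ℕ}

/-- The canonical map from the positive braid monoid to the braid group. -/
def toGroup (n : ℕ) : BraidMonoid (n - 1) →* BraidGroup n :=
  PresentedMonoid.lift braidGen (by
    rintro _ _ (⟨i, j, h⟩ | ⟨i, j, h⟩)
    · refine mul_inv_eq_one.1 ?_
      exact (PresentedGroup.one_of_mem (rels := braidRels n) ⟨i, j, .inl ⟨h, rfl⟩⟩)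
    · refine mul_inv_eq_one.1 ?_
      exact (PresentedGroup.one_of_mem (rels := braidRels n) ⟨i, j, .inr ⟨h, rfl⟩⟩))

@[simp] theorem toGroup_gen (i : Fin (n - 1)) : toGroup n (gen i) = braidGen i := rfl

/-- The map from the braid group to the units of the localized positive braid monoid. -/
noncomputable def groupToFrac (n : ℕ) : BraidGroup n →* (Frac (n - 1))ˣ :=
  PresentedGroup.toGroup (f := fun i => (isUnit_toFrac_gen i).unit) (by
    rintro _ ⟨i, j, ⟨h, rfl⟩ | ⟨h, rfl⟩⟩
    · simp only [map_mul, map_inv, FreeGroup.lift_apply_of, mul_inv_eq_one]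
      ext
      simp only [Units.val_mul, IsUnit.unit_spec, ← map_mul]
      rw [gen_braid (.inl h)]
    · simp only [map_mul, map_inv, FreeGroup.lift_apply_of, mul_inv_eq_one]
      ext
      simp only [Units.val_mul, IsUnit.unit_spec, ← map_mul]
      rw [gen_comm]
      unfold Adj; omega)

theorem groupToFrac_toGroup (x : BraidMonoid (n - 1)) :
    (groupToFrac n (toGroup n x) : Frac (n - 1)) = toFrac (n - 1) x := by
  induction x using induction with
  | one => simp
  | gen_mul i x ih =>
    rw [map_mul, map_mul, Units.val_mul, ih, map_mul]
    congr 1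
    exact congrArg Units.val (PresentedGroup.toGroup.of _)

theorem toGroup_injective (n : ℕ) : Function.Injective (toGroup n) := by
  intro x y h
  apply toFrac_injective
  rw [← groupToFrac_toGroup, h, groupToFrac_toGroup]

theorem toGroup_gen' (k : ℕ) : toGroup n (gen' (n - 1) k) = braidGen' n k := by
  unfold gen' braidGen'
  split <;> simp

theorem toGroup_asc (k : ℕ) : toGroup n (asc (n - 1) k) = braidAsc n k := by
  induction k with
  | zero => simp [asc, braidAsc]
  | succ k ih =>
    rw [asc, map_mul, ih, toGroup_gen', braidAsc, braidAsc, List.range_succ]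
    simp

theorem toGroup_delta (k : ℕ) : toGroup n (delta (n - 1) k) =
    ((List.range k).map fun j => braidAsc n (k - j)).prod := by
  induction k with
  | zero => simp [delta]
  | succ k ih =>
    rw [delta, map_mul, ih, toGroup_asc, List.range_succ_eq_map]
    simp [Function.comp_def]

theorem toGroup_delta_self (n : ℕ) : toGroup n (delta (n - 1) (n - 1)) = garside n :=
  toGroup_delta _

end BraidMonoid

namespace BraidGroup

open BraidMonoid

variable {n : ℕ}

theorem induction {P : BraidGroup n → Prop} (one : P 1)
    (mul_gen : ∀ i x, P x → P (x * braidGen i))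
    (mul_inv_gen : ∀ i x, P x → P (x * (braidGen i)⁻¹)) (x : BraidGroup n) : P x := by
  have hx : x ∈ Subgroup.closure (Set.range (braidGen (n := n))) := by
    have := PresentedGroup.closure_range_of (braidRels n)
    exact this ▸ Subgroup.mem_top (G := PresentedGroup (braidRels n)) x
  induction hx using Subgroup.closure_induction_right with
  | one => exact one
  | mul_right x y _ hy ih => obtain ⟨i, rfl⟩ := hy; exact mul_gen i x ih
  | mul_inv_cancel x y _ hy ih => obtain ⟨i, rfl⟩ := hy; exact mul_inv_gen i x ih

theorem garside_sq_comm (x : BraidGroup n) : Commute (garside n * garside n) x := by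
  have h : ∀ i, Commute (garside n * garside n) (braidGen i) := fun i => by
    simpa [toGroup_delta_self] using (delta_sq_comm (gen i)).map (toGroup n)
  induction x using induction with
  | one => exact .one_right _
  | mul_gen i x ih => exact ih.mul_right (h i)
  | mul_inv_gen i x ih => exact ih.mul_right (h i).inv_right

/-- Every braid becomes positive after multiplication by a power of the full twist. -/
theorem exists_mul_garside_sq_pow_eq (x : BraidGroup n) :
    ∃ k p, x * (garside n * garside n) ^ k = toGroup n p := by
  induction x using induction with
  | one => exact ⟨0, 1, by simp⟩
  | mul_gen i x ih =>
    obtain ⟨k, p, hp⟩ := ih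
    refine ⟨k, p * gen i, ?_⟩
    rw [map_mul, ← hp, mul_assoc, mul_assoc, ((garside_sq_comm _).pow_left k).eq, toGroup_gen]
  | mul_inv_gen i x ih =>
    obtain ⟨k, p, hp⟩ := ih
    obtain ⟨c, hc⟩ := gen_dvd_delta_self i
    refine ⟨k + 1, p * (c * delta (n - 1) (n - 1)), ?_⟩
    rw [map_mul, ← hp, mul_assoc, mul_assoc, ((garside_sq_comm _).pow_left k).eq, pow_succ',
      ← mul_assoc (braidGen i)⁻¹]
    congr 2
    rw [← toGroup_delta_self, hc]
    simp [mul_assoc]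

section Rev

variable {rev : BraidGroup n → BraidGroup n} (hmul : ∀ x y, rev (x * y) = rev y * rev x)
include hmul

theorem rev_one : rev 1 = 1 := by
  have := hmul 1 1
  rw [one_mul] at this
  exact left_eq_mul.1 this

theorem rev_inv (x : BraidGroup n) : rev x⁻¹ = (rev x)⁻¹ := by
  rw [eq_inv_iff_mul_eq_one, ← hmul, mul_inv_cancel, rev_one hmul]

theorem rev_pow {x : BraidGroup n} (hx : rev x = x) (k : ℕ) : rev (x ^ k) = x ^ k := by
  induction k with
  | zero => simp [rev_one hmul]
  | succ k ih => rw [pow_succ, hmul, ih, hx, ← pow_succ', pow_succ]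

theorem rev_toGroup (hgen : ∀ i, rev (braidGen i) = braidGen i) (x : BraidMonoid (n - 1)) :
    rev (toGroup n x) = toGroup n (BraidMonoid.rev x) := by
  induction x using BraidMonoid.induction with
  | one => simp [rev_one hmul]
  | gen_mul i x ih => simp [hmul, hgen, ih]

theorem rev_garside (hgen : ∀ i, rev (braidGen i) = braidGen i) : rev (garside n) = garside n := by
  rw [← toGroup_delta_self, rev_toGroup hmul hgen, rev_delta]

end Rev

end BraidGroup

open BraidMonoid BraidGroup in
/-- A pure palindromic braid is of the form `δ * rev δ`. -/
theorem exists_eq_mul_rev_of_rev_eq {m : ℕ} {rev : BraidGroup (m + 1) → BraidGroup (m + 1)}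
    (hmul : ∀ x y, rev (x * y) = rev y * rev x)
    (hgen : ∀ i, rev (braidGen i) = braidGen i)
    {π : BraidGroup (m + 1) →* Equiv.Perm (Fin (m + 1))}
    (hπ : ∀ i : Fin m, π (braidGen (n := m + 1) i) = Equiv.swap i.castSucc i.succ)
    {y : BraidGroup (m + 1)} (hy : rev y = y) (hπy : π y = 1) : ∃ δ, y = δ * rev δ := by
  obtain ⟨k, q, hq⟩ := exists_mul_garside_sq_pow_eq y
  set z := (garside (m + 1) * garside (m + 1)) ^ k with hz
  obtain ⟨p, hp⟩ : ∃ p, y * (z * z) = toGroup (m + 1) p := by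
    refine ⟨q * (delta (m + 1 - 1) (m + 1 - 1) * delta (m + 1 - 1) (m + 1 - 1)) ^ k, ?_⟩
    rw [map_mul, ← hq, map_pow, map_mul, toGroup_delta_self, mul_assoc]
  let f : BraidMonoid m →* Equiv.Perm (Fin (m + 1)) := π.comp (toGroup (m + 1))
  have hf : ∀ i, f (gen i) = Equiv.swap i.castSucc i.succ := hπ
  have hcomm : Commute z y := (garside_sq_comm y).pow_left k
  have hrz : rev z = z := rev_pow hmul (by rw [hmul, rev_garside hmul hgen]) k
  have hπz : π z = 1 := by
    have : π (garside (m + 1)) = Fin.revPerm := by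
      rw [← toGroup_delta_self]
      exact perm_delta_self hf
    have h : π (garside (m + 1)) * π (garside (m + 1)) = 1 := by
      rw [this]
      ext
      simp
    rw [hz, map_pow, map_mul, h, one_pow]
  have hrev : BraidMonoid.rev p = p := by
    apply toGroup_injective
    exact (rev_toGroup hmul hgen p).symm.trans (by
      rw [← hp, hmul, hmul, hrz, hy, (hcomm.mul_left hcomm).eq])
  have hfp : f p = 1 := by
    change π (toGroup (m + 1) p) = 1
    rw [← hp, map_mul, map_mul, hπz, hπy, one_mul, one_mul]
  obtain ⟨d, hd⟩ := exists_eq_mul_rev f (fun i => by rw [hf]; exact Equiv.swap_mul_self _ _)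
    gen_dvd_delta_self (fun a => eq_one_of_dvd_delta_of_perm_eq_one hf) hrev hfp
  have hd' : y * (z * z) = toGroup (m + 1) d * rev (toGroup (m + 1) d) := by
    rw [hp, hd, map_mul]
    exact congrArg _ (rev_toGroup hmul hgen d).symm
  refine ⟨z⁻¹ * toGroup (m + 1) d, ?_⟩
  rw [hmul, rev_inv hmul, hrz, mul_assoc, ← mul_assoc (toGroup _ _), ← hd',
    eq_inv_mul_iff_mul_eq, eq_mul_inv_iff_mul_eq, hcomm.eq, mul_assoc]

/-- Let `n ≥ 2` and `x ∈ B n` with `rev (Δₙ⁻¹ x Δₙ) = x` and `π x = π Δₙ`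
in the symmetric group.  Then `x = Δₙ * δ * rev δ` for some braid `δ`.  Here `rev` is the
involutive anti-automorphism fixing the generators, and `π` is the projection sending
`σ i` to the transposition `(i, i+1)`. -/
theorem eq_garside_mul_palindromization_of_rev_tau_invariant
    (n : ℕ) (hn : 2 ≤ n)
    (rev : BraidGroup n → BraidGroup n)
    (hmul : ∀ x y, rev (x * y) = rev y * rev x)
    (hinv : ∀ x, rev (rev x) = x)
    (hgen : ∀ i : Fin (n - 1), rev (braidGen i) = braidGen i)
    (π : BraidGroup n →* Equiv.Perm (Fin n))
    (hπ : ∀ i : Fin (n - 1),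
      π (braidGen i) =
        Equiv.swap (⟨(i : ℕ), by have := i.isLt; omega⟩ : Fin n)
          (⟨(i : ℕ) + 1, by have := i.isLt; omega⟩ : Fin n))
    (x : BraidGroup n)
    (hx : rev ((garside n)⁻¹ * x * garside n) = x)
    (hxΔ : π x = π (garside n)) :
    ∃ δ : BraidGroup n, x = garside n * δ * rev δ := by
  obtain ⟨m, rfl⟩ : ∃ m, n = m + 1 := ⟨n - 1, by omega⟩
  have hΔ := BraidGroup.rev_garside hmul hgen
  have hy : rev ((garside (m + 1))⁻¹ * x) = (garside (m + 1))⁻¹ * x := by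
    rw [hmul, hΔ] at hx
    exact eq_inv_mul_of_mul_eq hx
  obtain ⟨δ, hδ⟩ := exists_eq_mul_rev_of_rev_eq hmul hgen hπ hy (by
    rw [map_mul, map_inv, hxΔ, inv_mul_cancel])
  exact ⟨δ, by rw [mul_assoc, ← hδ, mul_inv_cancel_left]⟩
end
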